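/- arXiv:1401.6156 — 3 statements merged into one kernel-verified Lean document; each statement's English description precedes it below -/
import Mathlib

section
/- On the fermionic Fock space ℱ, the operators Λ_k (k a nonzero integer) satisfy the Heisenberg commutation relations: [Λ_n, Λ_m] = 0 whenever n, m are nonzero integers with n + m ≠ 0, and [Λ_k, Λ_{−k}] = k·id_ℱ for every integer k > 0. -/
open scoped Classical

/-- The multiset of contents `s − r` of a finite set of boxes `(r, s)`, as a finset. -/
def contentsOf (s : Finset (ℕ × ℕ)) : Finset ℤ :=
  s.image (fun p => (p.2 : ℤ) - (p.1 : ℤ))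

/-- A finite set of boxes is a skew hook if it is nonempty, no two of its boxes lie on
the same diagonal (the contents are pairwise distinct), and its contents form an
interval of integers. -/
def IsSkewHook (s : Finset (ℕ × ℕ)) : Prop :=
  s.Nonempty ∧ (contentsOf s).card = s.card ∧
    ∃ a : ℤ, contentsOf s = (Finset.range s.card).image (fun t => a + (t : ℤ))

/-- `L(λ/μ)`: the number of rows occupied by a skew shape, minus one. -/
def skewL (s : Finset (ℕ × ℕ)) : ℕ := (s.image Prod.fst).card - 1

/-- `hookStep k μ λ` holds when `μ ⊆ λ` and the skew shape `λ/μ` is a skew hook with `k`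
boxes. -/
def hookStep (k : ℕ) (μ lam : YoungDiagram) : Prop :=
  μ ≤ lam ∧ (lam.cells \ μ.cells).card = k ∧ IsSkewHook (lam.cells \ μ.cells)

/-- The fermionic Fock space: the complex vector space with basis `{v_λ}` indexed by all
partitions (= Young diagrams) `λ`. -/
abbrev FermionicFock : Type := YoungDiagram →₀ ℂ

/-- The image of the basis vector `v_λ` under `Λ_k`: for `k > 0`,
`Λ_k v_λ = Σ_μ (−1)^{L(λ/μ)} v_μ` over `μ ⊆ λ` with `λ/μ` a skew hook with `k` boxes;
for `k < 0`, `Λ_k v_λ = Σ_ν (−1)^{L(ν/λ)} v_ν` over `ν ⊇ λ` with `ν/λ` a skew hook with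
`|k|` boxes. -/
noncomputable def LamTarget (k : ℤ) (lam : YoungDiagram) : FermionicFock :=
  if 0 < k then
    ∑ᶠ μ : YoungDiagram, if hookStep k.toNat μ lam then
      ((-1 : ℂ) ^ skewL (lam.cells \ μ.cells)) • Finsupp.single μ (1 : ℂ) else 0
  else if k < 0 then
    ∑ᶠ ν : YoungDiagram, if hookStep (-k).toNat lam ν then
      ((-1 : ℂ) ^ skewL (ν.cells \ lam.cells)) • Finsupp.single ν (1 : ℂ) else 0
  else 0

/-- The operator `Λ_k` on the fermionic Fock space. -/
noncomputable def Lam (k : ℤ) : Module.End ℂ FermionicFock :=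
  Finsupp.lsum ℂ (fun lam => LinearMap.id.smulRight (LamTarget k lam))


/-! ### Maya diagrams, encoded by their bead counting functions -/

/-- A Maya diagram, encoded by the function `r c = #{beads at positions ≥ c}`. -/
structure Maya where
  r : ℤ → ℤ
  step : ∀ c, r c = r (c + 1) ∨ r c = r (c + 1) + 1
  bdd : ∃ N C : ℤ, (∀ c, N ≤ c → r c = 0) ∧ ∀ c, c ≤ -N → r c = C - c

theorem Maya.ext' {s t : Maya} (h : ∀ c, s.r c = t.r c) : s = t := by
  cases s; cases t
  simp only [Maya.mk.injEq]
  funext c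
  exact h c

/-- Add a bead at `a` (if possible). -/
noncomputable def Maya.up (a : ℤ) (s : Maya) : Maya :=
  if h : s.r a = s.r (a + 1) then
    { r := fun c => s.r c + if c ≤ a then 1 else 0
      step := by
        intro c
        have := s.step c
        by_cases hc : c = a
        · subst hc
          right
          simp [h]
        · split_ifs <;> omega
      bdd := by
        obtain ⟨N, C, h1, h2⟩ := s.bdd
        refine ⟨max N (|a| + 1), C + 1, fun c hc => ?_, fun c hc => ?_⟩
        · have := h1 c (by omega)
          have := le_abs_self a
          rw [if_neg (by omega)]
          omega
        · have := h2 c (by omega)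
          have := neg_abs_le a
          rw [if_pos (by omega)]
          omega }
  else s

/-- Remove a bead at `a` (if possible). -/
noncomputable def Maya.down (a : ℤ) (s : Maya) : Maya :=
  if h : s.r a = s.r (a + 1) + 1 then
    { r := fun c => s.r c - if c ≤ a then 1 else 0
      step := by
        intro c
        have := s.step c
        by_cases hc : c = a
        · subst hc
          left
          simp [h]
        · split_ifs <;> omega
      bdd := by
        obtain ⟨N, C, h1, h2⟩ := s.bdd
        refine ⟨max N (|a| + 1), C - 1, fun c hc => ?_, fun c hc => ?_⟩
        · have := h1 c (by omega)
          have := le_abs_self a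
          rw [if_neg (by omega)]
          omega
        · have := h2 c (by omega)
          have := neg_abs_le a
          rw [if_pos (by omega)]
          omega }
  else s

theorem Maya.up_r {a : ℤ} {s : Maya} (h : s.r a = s.r (a + 1)) (c : ℤ) :
    (s.up a).r c = s.r c + if c ≤ a then 1 else 0 := by
  rw [Maya.up, dif_pos h]

theorem Maya.down_r {a : ℤ} {s : Maya} (h : s.r a = s.r (a + 1) + 1) (c : ℤ) :
    (s.down a).r c = s.r c - if c ≤ a then 1 else 0 := by
  rw [Maya.down, dif_pos h]

/-- The Clifford module. -/
abbrev MFock : Type := Maya →₀ ℂ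

/-- Creation operator. -/
noncomputable def psi (a : ℤ) : Module.End ℂ MFock :=
  Finsupp.lsum ℂ (fun s => LinearMap.id.smulRight
    (if s.r a = s.r (a + 1) then
      ((-1 : ℂ) ^ (s.r (a + 1))) • (Finsupp.single (s.up a) (1 : ℂ) : MFock) else 0))

/-- Annihilation operator. -/
noncomputable def psis (a : ℤ) : Module.End ℂ MFock :=
  Finsupp.lsum ℂ (fun s => LinearMap.id.smulRight
    (if s.r a = s.r (a + 1) + 1 then
      ((-1 : ℂ) ^ (s.r (a + 1))) • (Finsupp.single (s.down a) (1 : ℂ) : MFock) else 0))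

theorem psi_single (a : ℤ) (s : Maya) : psi a (Finsupp.single s 1) =
    if s.r a = s.r (a + 1) then
      ((-1 : ℂ) ^ (s.r (a + 1))) • (Finsupp.single (s.up a) (1 : ℂ) : MFock) else 0 := by
  rw [psi, Finsupp.lsum_single]
  exact one_smul ℂ _

theorem psis_single (a : ℤ) (s : Maya) : psis a (Finsupp.single s 1) =
    if s.r a = s.r (a + 1) + 1 then
      ((-1 : ℂ) ^ (s.r (a + 1))) • (Finsupp.single (s.down a) (1 : ℂ) : MFock) else 0 := by
  rw [psis, Finsupp.lsum_single]
  exact one_smul ℂ _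

theorem mfock_ext {f g : Module.End ℂ MFock}
    (h : ∀ s, f (Finsupp.single s 1) = g (Finsupp.single s 1)) : f = g := by
  apply Finsupp.lhom_ext'
  intro s
  apply LinearMap.ext_ring
  exact h s

theorem sgn_succ (n : ℤ) : (-1 : ℂ) ^ (n + 1) = - (-1 : ℂ) ^ n := by
  rw [zpow_add₀ (by norm_num)]; simp

theorem sgn_pred (n : ℤ) : (-1 : ℂ) ^ (n - 1) = - (-1 : ℂ) ^ n := by
  rw [zpow_sub₀ (by norm_num)]; simp [div_neg]

theorem sgn_sq (n : ℤ) : (-1 : ℂ) ^ n * (-1 : ℂ) ^ n = 1 := by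
  rw [← mul_zpow]; simp

theorem psi_psi_lt {a b : ℤ} (hab : a < b) : psi a * psi b = - (psi b * psi a) := by
  apply mfock_ext
  intro s
  simp only [Module.End.mul_apply, LinearMap.neg_apply, psi_single]
  by_cases ha : s.r a = s.r (a + 1) <;> by_cases hb : s.r b = s.r (b + 1)
  · have e1 : (s.up b).r a = s.r a + 1 := by rw [Maya.up_r hb, if_pos (by omega)]
    have e2 : (s.up b).r (a + 1) = s.r (a + 1) + 1 := by rw [Maya.up_r hb, if_pos (by omega)]
    have e3 : (s.up a).r b = s.r b := by rw [Maya.up_r ha, if_neg (by omega), add_zero]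
    have e4 : (s.up a).r (b + 1) = s.r (b + 1) := by
      rw [Maya.up_r ha, if_neg (by omega), add_zero]
    have e5 : (s.up b).up a = (s.up a).up b := by
      apply Maya.ext'
      intro c
      rw [Maya.up_r (by omega), Maya.up_r hb, Maya.up_r (by omega), Maya.up_r ha]
      ring
    rw [if_pos ha, if_pos hb, map_smul, map_smul, psi_single, psi_single, if_pos (by omega),
      if_pos (by omega), e5, e2, e4, sgn_succ, smul_smul, smul_smul, ← neg_smul]
    congr 1; ring
  · have e3 : (s.up a).r b = s.r b := by rw [Maya.up_r ha, if_neg (by omega), add_zero]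
    have e4 : (s.up a).r (b + 1) = s.r (b + 1) := by
      rw [Maya.up_r ha, if_neg (by omega), add_zero]
    rw [if_pos ha, if_neg hb, map_smul, psi_single, if_neg (by omega)]
    simp
  · have e1 : (s.up b).r a = s.r a + 1 := by rw [Maya.up_r hb, if_pos (by omega)]
    have e2 : (s.up b).r (a + 1) = s.r (a + 1) + 1 := by rw [Maya.up_r hb, if_pos (by omega)]
    rw [if_neg ha, if_pos hb, map_smul, psi_single, if_neg (by omega)]
    simp
  · simp [ha, hb]

theorem psi_psi_self (a : ℤ) : psi a * psi a = 0 := by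
  apply mfock_ext
  intro s
  simp only [Module.End.mul_apply, LinearMap.zero_apply, psi_single]
  by_cases ha : s.r a = s.r (a + 1)
  · have e1 : (s.up a).r a = s.r a + 1 := by rw [Maya.up_r ha, if_pos (by omega)]
    have e2 : (s.up a).r (a + 1) = s.r (a + 1) := by
      rw [Maya.up_r ha, if_neg (by omega), add_zero]
    rw [if_pos ha, map_smul, psi_single, if_neg (by omega), smul_zero]
  · simp [ha]

theorem psi_psi (a b : ℤ) : psi a * psi b = - (psi b * psi a) := by
  rcases lt_trichotomy a b with h | h | h
  · exact psi_psi_lt h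
  · subst h; rw [psi_psi_self]; exact (neg_zero (G := Module.End ℂ MFock)).symm
  · rw [psi_psi_lt h]; exact (neg_neg (psi a * psi b)).symm

theorem psis_psis_lt {a b : ℤ} (hab : a < b) : psis a * psis b = - (psis b * psis a) := by
  apply mfock_ext
  intro s
  simp only [Module.End.mul_apply, LinearMap.neg_apply, psis_single]
  by_cases ha : s.r a = s.r (a + 1) + 1 <;> by_cases hb : s.r b = s.r (b + 1) + 1
  · have e1 : (s.down b).r a = s.r a - 1 := by rw [Maya.down_r hb, if_pos (by omega)]
    have e2 : (s.down b).r (a + 1) = s.r (a + 1) - 1 := by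
      rw [Maya.down_r hb, if_pos (by omega)]
    have e3 : (s.down a).r b = s.r b := by rw [Maya.down_r ha, if_neg (by omega), sub_zero]
    have e4 : (s.down a).r (b + 1) = s.r (b + 1) := by
      rw [Maya.down_r ha, if_neg (by omega), sub_zero]
    have e5 : (s.down b).down a = (s.down a).down b := by
      apply Maya.ext'
      intro c
      rw [Maya.down_r (by omega), Maya.down_r hb, Maya.down_r (by omega), Maya.down_r ha]
      ring
    rw [if_pos ha, if_pos hb, map_smul, map_smul, psis_single, psis_single, if_pos (by omega),
      if_pos (by omega), e5, e2, e4, sgn_pred, smul_smul, smul_smul, ← neg_smul]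
    congr 1; ring
  · have e3 : (s.down a).r b = s.r b := by rw [Maya.down_r ha, if_neg (by omega), sub_zero]
    have e4 : (s.down a).r (b + 1) = s.r (b + 1) := by
      rw [Maya.down_r ha, if_neg (by omega), sub_zero]
    rw [if_pos ha, if_neg hb, map_smul, psis_single, if_neg (by omega)]
    simp
  · have e1 : (s.down b).r a = s.r a - 1 := by rw [Maya.down_r hb, if_pos (by omega)]
    have e2 : (s.down b).r (a + 1) = s.r (a + 1) - 1 := by
      rw [Maya.down_r hb, if_pos (by omega)]
    rw [if_neg ha, if_pos hb, map_smul, psis_single, if_neg (by omega)]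
    simp
  · simp [ha, hb]

theorem psis_psis_self (a : ℤ) : psis a * psis a = 0 := by
  apply mfock_ext
  intro s
  simp only [Module.End.mul_apply, LinearMap.zero_apply, psis_single]
  by_cases ha : s.r a = s.r (a + 1) + 1
  · have e1 : (s.down a).r a = s.r a - 1 := by rw [Maya.down_r ha, if_pos (by omega)]
    have e2 : (s.down a).r (a + 1) = s.r (a + 1) := by
      rw [Maya.down_r ha, if_neg (by omega), sub_zero]
    rw [if_pos ha, map_smul, psis_single, if_neg (by omega), smul_zero]
  · simp [ha]

theorem psis_psis (a b : ℤ) : psis a * psis b = - (psis b * psis a) := by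
  rcases lt_trichotomy a b with h | h | h
  · exact psis_psis_lt h
  · subst h; rw [psis_psis_self]; exact (neg_zero (G := Module.End ℂ MFock)).symm
  · rw [psis_psis_lt h]; exact (neg_neg (psis a * psis b)).symm

theorem psis_psi_ne {a b : ℤ} (hab : a ≠ b) : psis a * psi b = - (psi b * psis a) := by
  apply mfock_ext
  intro s
  simp only [Module.End.mul_apply, LinearMap.neg_apply, psi_single, psis_single]
  by_cases ha : s.r a = s.r (a + 1) + 1 <;> by_cases hb : s.r b = s.r (b + 1)
  · have e1 := Maya.up_r hb a
    have e2 := Maya.up_r hb (a + 1)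
    have e3 := Maya.down_r ha b
    have e4 := Maya.down_r ha (b + 1)
    have c1 : (s.up b).r a = (s.up b).r (a + 1) + 1 := by
      rw [e1, e2]; split_ifs <;> omega
    have c2 : (s.down a).r b = (s.down a).r (b + 1) := by
      rw [e3, e4]; split_ifs <;> omega
    have e5 : (s.up b).down a = (s.down a).up b := by
      apply Maya.ext'
      intro c
      rw [Maya.down_r c1, Maya.up_r hb, Maya.up_r c2, Maya.down_r ha]
      ring
    rw [if_pos ha, if_pos hb, map_smul, map_smul, psi_single, psis_single, if_pos c1,
      if_pos c2, e5, e2, e4, smul_smul, smul_smul, ← neg_smul]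
    congr 1
    rcases lt_or_gt_of_ne hab with h | h
    · rw [if_pos (by omega), if_neg (by omega), sgn_succ, sub_zero]; ring
    · rw [if_neg (by omega), if_pos (by omega), sgn_pred, add_zero]; ring
  · have e3 := Maya.down_r ha b
    have e4 := Maya.down_r ha (b + 1)
    have c2 : ¬ (s.down a).r b = (s.down a).r (b + 1) := by
      rw [e3, e4]; split_ifs <;> omega
    rw [if_pos ha, if_neg hb, map_smul, psi_single, if_neg c2]
    simp
  · have e1 := Maya.up_r hb a
    have e2 := Maya.up_r hb (a + 1)
    have c1 : ¬ (s.up b).r a = (s.up b).r (a + 1) + 1 := by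
      rw [e1, e2]; split_ifs <;> omega
    rw [if_neg ha, if_pos hb, map_smul, psis_single, if_neg c1]
    simp
  · simp [ha, hb]

theorem psis_psi_self (a : ℤ) : psis a * psi a = 1 - psi a * psis a := by
  apply mfock_ext
  intro s
  simp only [Module.End.mul_apply, LinearMap.sub_apply, Module.End.one_apply, psi_single,
    psis_single]
  rcases s.step a with ha | ha
  · have e1 : (s.up a).r a = s.r a + 1 := by rw [Maya.up_r ha, if_pos (by omega)]
    have e2 : (s.up a).r (a + 1) = s.r (a + 1) := by
      rw [Maya.up_r ha, if_neg (by omega), add_zero]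
    have e5 : (s.up a).down a = s := by
      apply Maya.ext'
      intro c
      rw [Maya.down_r (by omega), Maya.up_r ha]; ring
    rw [if_pos ha, if_neg (by omega), map_smul, psis_single, if_pos (by omega), e5, e2, smul_smul,
      sgn_sq]
    simp
  · have e1 : (s.down a).r a = s.r a - 1 := by rw [Maya.down_r ha, if_pos (by omega)]
    have e2 : (s.down a).r (a + 1) = s.r (a + 1) := by
      rw [Maya.down_r ha, if_neg (by omega), sub_zero]
    have e5 : (s.down a).up a = s := by
      apply Maya.ext'
      intro c
      rw [Maya.up_r (by omega), Maya.down_r ha]; ring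
    rw [if_pos ha, if_neg (by omega), map_smul, psi_single, if_pos (by omega), e5, e2, smul_smul,
      sgn_sq]
    simp

theorem psis_psi (a b : ℤ) :
    psis a * psi b = (if a = b then 1 else 0) - psi b * psis a := by
  by_cases h : a = b
  · subst h; rw [if_pos rfl, psis_psi_self]
  · rw [if_neg h, psis_psi_ne h]; exact (zero_sub (psi b * psis a)).symm

/-- The elementary operator moving a bead from `b` to `a`. -/
noncomputable def EE (a b : ℤ) : Module.End ℂ MFock := psi a * psis b

theorem EE_comm_aux {R : Type*} [Ring R] (p q : ℤ → R) (h1 : ∀ a b, p a * p b = - (p b * p a))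
    (h2 : ∀ a b, q a * q b = - (q b * q a))
    (h3 : ∀ a b, q a * p b = (if a = b then 1 else 0) - p b * q a) (a b c d : ℤ) :
    (p a * q b) * (p c * q d) + (if d = a then p c * q b else 0) =
      (p c * q d) * (p a * q b) + (if b = c then p a * q d else 0) := by
  have e1 : (p a * q b) * (p c * q d) = p a * (q b * p c) * q d := by
    simp only [mul_assoc]
  have e2 : (p c * q d) * (p a * q b) = p c * (q d * p a) * q b := by
    simp only [mul_assoc]
  have e3 : p a * (p c * q b) * q d = p c * (p a * q d) * q b := by
    calc p a * (p c * q b) * q d = (p a * p c) * (q b * q d) := by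
          simp only [mul_assoc]
      _ = (p c * p a) * (q d * q b) := by
          rw [h1 a c, h2 b d, neg_mul_neg]
      _ = _ := by simp only [mul_assoc]
  rw [e1, e2, h3, h3, mul_sub, sub_mul, mul_sub, sub_mul, e3]
  have h4 : ∀ (P : Prop) [Decidable P] (x y : ℤ),
      p x * (if P then 1 else 0) * q y = if P then p x * q y else 0 := by
    intro P _ x y
    split_ifs <;> simp
  rw [h4, h4]
  abel

theorem EE_comm (a b c d : ℤ) : EE a b * EE c d + (if d = a then EE c b else 0) =
    EE c d * EE a b + (if b = c then EE a d else 0) :=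
  EE_comm_aux psi psis psi_psi psis_psis psis_psi a b c d

/-! ### Partitions as Maya diagrams -/

theorem rfun_exists (lam : YoungDiagram) (c : ℤ) :
    ∃ i : ℕ, ¬ ((i : ℤ) + c < 0 ∨ (i, ((i : ℤ) + c).toNat) ∈ lam) := by
  refine ⟨(-c).toNat + lam.colLen 0, ?_⟩
  rintro (h | h)
  · omega
  · have h2 := lam.up_left_mem le_rfl (Nat.zero_le _) h
    rw [YoungDiagram.mem_iff_lt_colLen] at h2
    omega

/-- Number of beads at positions `≥ c` in the Maya diagram of `lam`. -/
noncomputable def rfun (lam : YoungDiagram) (c : ℤ) : ℕ := Nat.find (rfun_exists lam c)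

theorem lt_rfun {lam : YoungDiagram} {c : ℤ} {i : ℕ} :
    i < rfun lam c ↔ ((i : ℤ) + c < 0 ∨ (i, ((i : ℤ) + c).toNat) ∈ lam) := by
  rw [rfun, Nat.lt_find_iff]
  constructor
  · intro h
    exact not_not.1 (h i le_rfl)
  · intro h m hm
    rw [not_not]
    rcases h with h | h
    · left; omega
    · right
      exact lam.up_left_mem hm (by omega) h

theorem mem_iff_rfun {lam : YoungDiagram} {i j : ℕ} :
    (i, j) ∈ lam ↔ i < rfun lam ((j : ℤ) - i) := by
  rw [lt_rfun]
  have : ((i : ℤ) + (j - i)).toNat = j := by omega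
  rw [this]
  constructor
  · exact Or.inr
  · rintro (h | h)
    · omega
    · exact h

theorem rfun_ge (lam : YoungDiagram) (c : ℤ) : 0 ≤ (rfun lam c : ℤ) + c := by
  by_contra h
  have : rfun lam c < rfun lam c := lt_rfun.2 (Or.inl (by omega))
  omega

theorem rfun_step (lam : YoungDiagram) (c : ℤ) :
    rfun lam c = rfun lam (c + 1) ∨ rfun lam c = rfun lam (c + 1) + 1 := by
  have h1 : rfun lam (c + 1) ≤ rfun lam c := by
    by_contra h
    rw [not_le, lt_rfun] at h
    have : rfun lam c < rfun lam c := by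
      conv_rhs => rw [← Nat.cast_id (rfun lam c)]
      refine lt_rfun.2 ?_
      rcases h with h | h
      · left; omega
      · right; exact lam.up_left_mem le_rfl (by omega) h
    omega
  have h2 : rfun lam c ≤ rfun lam (c + 1) + 1 := by
    by_contra h
    rw [not_le, lt_rfun] at h
    have : rfun lam (c + 1) < rfun lam (c + 1) := by
      refine lt_rfun.2 ?_
      rcases h with h | h
      · left; push_cast at h; omega
      · right; exact lam.up_left_mem (by omega) (by omega) h
    omega
  omega

theorem rfun_high (lam : YoungDiagram) (c : ℤ) (hc : lam.rowLen 0 ≤ c) : rfun lam c = 0 := by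
  by_contra h
  have h : 0 < rfun lam c := Nat.pos_of_ne_zero h
  rw [lt_rfun] at h
  rcases h with h | h
  · omega
  · rw [YoungDiagram.mem_iff_lt_rowLen] at h
    omega

theorem rfun_low (lam : YoungDiagram) (c : ℤ) (hc : c ≤ -(lam.colLen 0 : ℤ)) :
    (rfun lam c : ℤ) = -c := by
  have h0 := rfun_ge lam c
  by_contra h
  have h : (-c).toNat < rfun lam c := by omega
  rw [lt_rfun] at h
  rcases h with h | h
  · omega
  · have h2 := lam.up_left_mem le_rfl (Nat.zero_le _) h
    rw [YoungDiagram.mem_iff_lt_colLen] at h2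
    omega

/-- The Maya diagram of a partition. -/
noncomputable def toMaya (lam : YoungDiagram) : Maya where
  r c := rfun lam c
  step c := by
    have := rfun_step lam c
    omega
  bdd := by
    refine ⟨max (lam.rowLen 0) (lam.colLen 0), 0, fun c hc => ?_, fun c hc => ?_⟩
    · rw [rfun_high lam c (by omega)]; rfl
    · rw [rfun_low lam c (by omega)]; ring

theorem toMaya_injective : Function.Injective toMaya := by
  intro lam mu h
  have h2 : ∀ c, rfun lam c = rfun mu c := by
    intro c
    have : (toMaya lam).r c = (toMaya mu).r c := by rw [h]
    exact Int.ofNat.inj this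
  apply SetLike.ext
  rintro ⟨i, j⟩
  rw [mem_iff_rfun, mem_iff_rfun, h2]

theorem toMaya_surj (s : Maya) (hs : ∃ N : ℤ, ∀ c, c ≤ -N → s.r c = -c) :
    ∃ lam, toMaya lam = s := by
  obtain ⟨N1, h1⟩ := hs
  obtain ⟨N2, C, h2, -⟩ := s.bdd
  obtain ⟨N, hN1, hN2⟩ : ∃ N : ℕ, N1 ≤ N ∧ N2 ≤ N :=
    ⟨(max N1 N2).toNat, by omega, by omega⟩
  have hlow : ∀ c, c ≤ -(N : ℤ) → s.r c = -c := fun c hc => h1 c (by omega)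
  have hhigh : ∀ c, (N : ℤ) ≤ c → s.r c = 0 := fun c hc => h2 c (by omega)
  have anti : Antitone s.r := antitone_int_of_succ_le (fun c => by have := s.step c; omega)
  have mono : Monotone (fun c => s.r c + c) :=
    monotone_int_of_le_succ (fun c => by have := s.step c; omega)
  have pos : ∀ c, 0 ≤ s.r c := by
    intro c
    have := anti (le_max_left c N)
    rw [hhigh _ (le_max_right c N)] at this
    exact this
  have pos' : ∀ c, 0 ≤ s.r c + c := by
    intro c
    have := mono (min_le_left c (-N))
    simp only [hlow _ (min_le_right c (-N))] at this
    omega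
  let cells : Finset (ℕ × ℕ) := (Finset.range N ×ˢ Finset.range (2 * N)).filter
    (fun p => (p.1 : ℤ) < s.r ((p.2 : ℤ) - p.1))
  have hmem : ∀ i j : ℕ, (i, j) ∈ cells ↔ (i : ℤ) < s.r ((j : ℤ) - i) := by
    intro i j
    simp only [cells, Finset.mem_filter, Finset.mem_product, Finset.mem_range,
      and_iff_right_iff_imp]
    intro h
    have a1 : -(N : ℤ) < (j : ℤ) - i := by
      by_contra hc
      rw [hlow _ (by omega)] at h
      omega
    have a2 : (j : ℤ) - i < N := by
      by_contra hc
      rw [hhigh _ (by omega)] at h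
      omega
    have a3 := anti a1.le
    rw [hlow _ le_rfl] at a3
    omega
  have hlower : IsLowerSet (cells : Set (ℕ × ℕ)) := by
    rintro ⟨i, j⟩ ⟨i', j'⟩ ⟨hi, hj⟩ h
    simp only at hi hj
    rw [Finset.mem_coe, hmem] at h ⊢
    have a1 : s.r ((j : ℤ) - i) ≤ s.r ((j' : ℤ) - i) := anti (by omega)
    have a2 := mono (show (j' : ℤ) - i ≤ (j' : ℤ) - i' by omega)
    simp only at a2
    omega
  refine ⟨⟨cells, hlower⟩, ?_⟩
  apply Maya.ext'
  intro c
  have key : ∀ i : ℕ, i < rfun ⟨cells, hlower⟩ c ↔ (i : ℤ) < s.r c := by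
    intro i
    rw [lt_rfun, YoungDiagram.mem_mk, hmem]
    have := pos' c
    by_cases hc : (i : ℤ) + c < 0
    · simp only [hc, true_or, true_iff]; omega
    · simp only [hc, false_or]
      rw [show (((i : ℤ) + c).toNat : ℤ) - i = c by omega]
  have k1 := key (rfun ⟨cells, hlower⟩ c)
  have k2 := key (s.r c).toNat
  have := pos c
  show ((rfun ⟨cells, hlower⟩ c : ℕ) : ℤ) = s.r c
  omega

theorem rfun_mono {mu lam : YoungDiagram} (h : mu ≤ lam) (c : ℤ) : rfun mu c ≤ rfun lam c := by
  by_contra hc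
  rw [not_le, lt_rfun] at hc
  have : rfun lam c < rfun lam c := by
    refine lt_rfun.2 (hc.imp_right fun hh => h hh)
  omega

theorem mem_hook_interval (a x : ℤ) (s : Finset (ℕ × ℕ)) :
    x ∈ (Finset.range s.card).image (fun t => a + (t : ℤ)) ↔ a ≤ x ∧ x < a + s.card := by
  simp only [Finset.mem_image, Finset.bind_def, Finset.pure_def, Finset.mem_sup,
    Finset.mem_singleton, Finset.mem_range]
  constructor
  · rintro ⟨t, ⟨n, hn, rfl⟩, rfl⟩
    omega
  · intro h
    exact ⟨x - a, ⟨(x - a).toNat, by omega, by omega⟩, by omega⟩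

theorem hookStep_forward {k : ℕ} {mu lam : YoungDiagram} (h : hookStep k mu lam) :
    ∃ p : ℤ, ∀ c, rfun lam c = rfun mu c + if p < c ∧ c ≤ p + k then 1 else 0 := by
  obtain ⟨hle, hcard, -, hinj, a, ha⟩ := h
  refine ⟨a - 1, fun c => ?_⟩
  have hmem : ∀ i : ℕ, rfun mu c ≤ i → i < rfun lam c →
      (i, ((i : ℤ) + c).toNat) ∈ lam.cells \ mu.cells ∧
      (((i : ℤ) + c).toNat : ℤ) = i + c := by
    intro i h1 h2
    have h3 := rfun_ge mu c
    have h4 : (((i : ℤ) + c).toNat : ℤ) = i + c := by omega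
    refine ⟨?_, h4⟩
    rw [Finset.mem_sdiff, YoungDiagram.mem_cells, YoungDiagram.mem_cells, mem_iff_rfun,
      mem_iff_rfun, h4, show (i : ℤ) + c - i = c by ring]
    omega
  have hmono := rfun_mono hle c
  have hinj' := Finset.card_image_iff.1 hinj
  have hone : rfun lam c ≤ rfun mu c + 1 := by
    by_contra hc
    obtain ⟨m1, e1⟩ := hmem (rfun mu c) le_rfl (by omega)
    obtain ⟨m2, e2⟩ := hmem (rfun mu c + 1) (by omega) (by omega)
    have := hinj' (Finset.mem_coe.2 m1) (Finset.mem_coe.2 m2) (by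
      simp only [e1, e2]; ring)
    simp at this
  have hc1 : rfun mu c < rfun lam c ↔ c ∈ contentsOf (lam.cells \ mu.cells) := by
    constructor
    · intro h
      obtain ⟨m1, e1⟩ := hmem (rfun mu c) le_rfl h
      refine Finset.mem_image.2 ⟨_, m1, ?_⟩
      simp only [e1]; ring
    · intro h
      obtain ⟨⟨i, j⟩, m, e⟩ := Finset.mem_image.1 h
      simp only at e
      rw [Finset.mem_sdiff, YoungDiagram.mem_cells, YoungDiagram.mem_cells, mem_iff_rfun,
        mem_iff_rfun, e] at m
      omega
  have hc2 : c ∈ contentsOf (lam.cells \ mu.cells) ↔ (a - 1 < c ∧ c ≤ a - 1 + k) := by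
    rw [ha, mem_hook_interval, hcard]
    omega
  rw [hc2] at hc1
  split_ifs with hh
  · have := hc1.2 hh; omega
  · have := mt hc1.1 hh; omega

theorem image_Ioc_step (f : ℤ → ℕ) (hf : ∀ c, f c = f (c + 1) ∨ f c = f (c + 1) + 1) (p : ℤ)
    (n : ℕ) : (Finset.Ioc p (p + n + 1)).image f = Finset.Icc (f (p + n + 1)) (f (p + 1)) ∧
      f (p + n + 1) ≤ f (p + 1) := by
  induction n with
  | zero =>
    have : Finset.Ioc p (p + (0 : ℕ) + 1) = {p + 1} := by
      ext x; simp only [Finset.mem_Ioc, Finset.mem_singleton]; push_cast; omega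
    rw [this]; simp
  | succ n ih =>
    have h1 : Finset.Ioc p (p + ((n + 1 : ℕ) : ℤ) + 1) =
        insert (p + n + 1 + 1) (Finset.Ioc p (p + n + 1)) := by
      ext x; simp only [Finset.mem_Ioc, Finset.mem_insert]; push_cast; omega
    have h2 : p + ((n + 1 : ℕ) : ℤ) + 1 = p + n + 1 + 1 := by push_cast; ring
    have h3 := hf (p + n + 1)
    rw [h1, h2, Finset.image_insert, ih.1]
    obtain ⟨-, ih2⟩ := ih
    refine ⟨?_, by omega⟩
    ext x
    simp only [Finset.mem_insert, Finset.mem_Icc]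
    omega

theorem hookStep_backward {k : ℕ} (hk : 0 < k) {mu lam : YoungDiagram} {p : ℤ}
    (h : ∀ c, rfun lam c = rfun mu c + if p < c ∧ c ≤ p + k then 1 else 0) :
    hookStep k mu lam ∧
      (skewL (lam.cells \ mu.cells) : ℤ) = rfun mu (p + 1) - rfun mu (p + k) := by
  have hle : mu ≤ lam := by
    rintro ⟨i, j⟩ hm
    have hm : (i, j) ∈ mu := hm
    show (i, j) ∈ lam
    rw [mem_iff_rfun] at hm ⊢
    rw [h]; omega
  have hj : ∀ c, (((rfun mu c : ℤ) + c).toNat : ℤ) = rfun mu c + c := by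
    intro c
    have := rfun_ge mu c
    omega
  have hcells : lam.cells \ mu.cells = (Finset.Ioc p (p + k)).image
      (fun c => (rfun mu c, ((rfun mu c : ℤ) + c).toNat)) := by
    ext ⟨i, j⟩
    rw [Finset.mem_sdiff, YoungDiagram.mem_cells, YoungDiagram.mem_cells, mem_iff_rfun,
        mem_iff_rfun, h, Finset.mem_image]
    constructor
    · intro hm
      refine ⟨(j : ℤ) - i, ?_, ?_⟩
      · rw [Finset.mem_Ioc]
        by_contra hc
        rw [if_neg hc] at hm
        omega
      · have : rfun mu ((j : ℤ) - i) = i := by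
          split_ifs at hm <;> omega
        rw [this, Prod.mk.injEq]
        omega
    · rintro ⟨c, hc, e⟩
      rw [Finset.mem_Ioc] at hc
      rw [Prod.mk.injEq] at e
      have := hj c
      have e3 : (j : ℤ) - i = c := by omega
      rw [e3, if_pos hc]
      omega
  have hcont : contentsOf (lam.cells \ mu.cells) = Finset.Ioc p (p + k) := by
    rw [contentsOf, hcells, Finset.image_image]
    have e : ((fun p : ℕ × ℕ => (p.2 : ℤ) - (p.1 : ℤ)) ∘
        fun c => (rfun mu c, ((rfun mu c : ℤ) + c).toNat)) = id := by
      funext c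
      simp only [Function.comp, hj, id]
      ring
    rw [e, Finset.image_id]
  have hcard : (lam.cells \ mu.cells).card = k := by
    rw [hcells, Finset.card_image_of_injOn]
    · simp
    · intro c _ c' _ e
      simp only [Prod.mk.injEq] at e
      have h1 := hj c
      have h2 := hj c'
      omega
  refine ⟨⟨hle, hcard, ?_, ?_, p + 1, ?_⟩, ?_⟩
  · rw [← Finset.card_pos, hcard]; exact hk
  · rw [hcont, hcard]; simp
  · ext x
    rw [mem_hook_interval, hcont, hcard, Finset.mem_Ioc]
    omega
  · obtain ⟨n, rfl⟩ : ∃ n, k = n + 1 := ⟨k - 1, by omega⟩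
    obtain ⟨h1, h2⟩ := image_Ioc_step (rfun mu) (rfun_step mu) p n
    have e : p + ((n + 1 : ℕ) : ℤ) = p + n + 1 := by push_cast; ring
    rw [skewL, hcells, Finset.image_image, e]
    have : (Prod.fst ∘ fun c => (rfun mu c, ((rfun mu c : ℤ) + c).toNat)) = rfun mu := rfl
    rw [this, h1, Nat.card_Icc]
    omega

/-! ### The bosonic operators in terms of bead moves -/

/-- The condition that a bead at `a` can be moved to `a - k`. -/
def canMove (k : ℤ) (s : Maya) (a : ℤ) : Prop :=
  s.r a = s.r (a + 1) + 1 ∧ s.r (a - k) = s.r (a - k + 1)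

theorem canMove_down {k : ℤ} (hk : k ≠ 0) {s : Maya} {a : ℤ} (h : s.r a = s.r (a + 1) + 1) :
    (s.down a).r (a - k) = (s.down a).r (a - k + 1) ↔ s.r (a - k) = s.r (a - k + 1) := by
  rw [Maya.down_r h, Maya.down_r h]
  split_ifs <;> omega

theorem move_r {k : ℤ} (hk : k ≠ 0) {s : Maya} {a : ℤ} (h : canMove k s a) (c : ℤ) :
    ((s.down a).up (a - k)).r c =
      s.r c - (if c ≤ a then 1 else 0) + (if c ≤ a - k then 1 else 0) := by
  rw [Maya.up_r ((canMove_down hk h.1).2 h.2), Maya.down_r h.1]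

theorem EE_single {k : ℤ} (hk : k ≠ 0) (s : Maya) (a : ℤ) :
    EE (a - k) a (Finsupp.single s 1) = if canMove k s a then
      ((-1 : ℂ) ^ (s.r (a + 1) + (s.down a).r (a - k + 1))) •
        (Finsupp.single ((s.down a).up (a - k)) (1 : ℂ) : MFock) else 0 := by
  rw [EE, Module.End.mul_apply, psis_single]
  by_cases h1 : s.r a = s.r (a + 1) + 1
  · rw [if_pos h1, map_smul, psi_single]
    by_cases h2 : s.r (a - k) = s.r (a - k + 1)
    · rw [if_pos ((canMove_down hk h1).2 h2), if_pos ⟨h1, h2⟩, smul_smul,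
        zpow_add₀ (by norm_num)]
    · rw [if_neg (mt (canMove_down hk h1).1 h2), if_neg (fun h => h2 h.2), smul_zero]
  · rw [if_neg h1, if_neg (fun h => h1 h.1), map_zero]

theorem EE_self_single (s : Maya) (a : ℤ) (ha : s.r a = s.r (a + 1) + 1) :
    EE a a (Finsupp.single s 1) = Finsupp.single s 1 := by
  have e1 : (s.down a).r a = s.r a - 1 := by rw [Maya.down_r ha, if_pos (by omega)]
  have e2 : (s.down a).r (a + 1) = s.r (a + 1) := by
    rw [Maya.down_r ha, if_neg (by omega), sub_zero]
  have e5 : (s.down a).up a = s := by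
    apply Maya.ext'
    intro c
    rw [Maya.up_r (by omega), Maya.down_r ha]; ring
  rw [EE, Module.End.mul_apply, psis_single, if_pos ha, map_smul, psi_single, if_pos (by omega),
    e5, e2, smul_smul, sgn_sq, one_smul]

theorem EE_zero_single (s : Maya) (a b : ℤ) (ha : s.r a = s.r (a + 1)) :
    EE b a (Finsupp.single s 1) = 0 := by
  rw [EE, Module.End.mul_apply, psis_single, if_neg (by omega), map_zero]

open Filter in
theorem EE_small (p : ℤ) (w : MFock) : ∀ᶠ N : ℤ in atTop, ∀ a,
    (a < -N → EE (a - p) a w = if p = 0 then w else 0) ∧ (N < a → EE (a - p) a w = 0) := by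
  induction w using Finsupp.induction_linear with
  | zero => simp
  | add f g hf hg =>
    filter_upwards [hf, hg] with N h1 h2 a
    refine ⟨fun ha => ?_, fun ha => ?_⟩
    · rw [map_add, (h1 a).1 ha, (h2 a).1 ha]
      split_ifs
      · rfl
      · exact add_zero _
    · rw [map_add, (h1 a).2 ha, (h2 a).2 ha]
      exact add_zero _
  | single s x =>
    obtain ⟨M, C, h1, h2⟩ := s.bdd
    have hx : (Finsupp.single s x : MFock) = x • Finsupp.single s (1 : ℂ) := by
      rw [Finsupp.smul_single, smul_eq_mul, mul_one]
    filter_upwards [eventually_ge_atTop (|M| + |p| + 1)] with N hN a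
    have b1 := le_abs_self M
    have b2 := neg_abs_le p
    have b3 := le_abs_self p
    refine ⟨fun ha => ?_, fun ha => ?_⟩
    · have c1 := h2 a (by omega)
      have c2 := h2 (a + 1) (by omega)
      have c3 := h2 (a - p) (by omega)
      have c4 := h2 (a - p + 1) (by omega)
      rw [hx, map_smul]
      by_cases hp : p = 0
      · subst hp
        rw [if_pos rfl, sub_zero, EE_self_single s a (by omega)]
      · rw [if_neg hp, EE_single hp, if_neg, smul_zero]
        rintro ⟨d1, d2⟩
        omega
    · have c1 := h1 a (by omega)
      have c2 := h1 (a + 1) (by omega)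
      rw [hx, map_smul, EE_zero_single s a _ (by omega), smul_zero]

/-- The embedding of the Fock space into the Clifford module. -/
noncomputable def Phi : FermionicFock →ₗ[ℂ] MFock := Finsupp.lmapDomain ℂ ℂ toMaya

theorem Phi_injective : Function.Injective Phi :=
  Finsupp.mapDomain_injective toMaya_injective

theorem Phi_single (lam : YoungDiagram) (x : ℂ) :
    Phi (Finsupp.single lam x) = Finsupp.single (toMaya lam) x :=
  Finsupp.mapDomain_single

theorem move_exists {k : ℤ} (hk : k ≠ 0) {lam : YoungDiagram} {a : ℤ}
    (h : canMove k (toMaya lam) a) :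
    ∃ mu, toMaya mu = ((toMaya lam).down a).up (a - k) := by
  apply toMaya_surj
  refine ⟨lam.colLen 0 + |a| + |k|, fun c hc => ?_⟩
  have b1 := neg_abs_le a
  have b2 := le_abs_self k
  have b3 := abs_nonneg k
  have b4 := abs_nonneg a
  rw [move_r hk h, if_pos (by omega), if_pos (by omega)]
  have := rfun_low lam c (by omega)
  show (rfun lam c : ℤ) - 1 + 1 = -c
  omega

theorem move_inj {k : ℤ} (hk : k ≠ 0) {s : Maya} {a b : ℤ}
    (ha : canMove k s a) (hb : canMove k s b)
    (h : (s.down a).up (a - k) = (s.down b).up (b - k)) : a = b := by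
  have key : ∀ c, s.r c - (if c ≤ a then 1 else 0) + (if c ≤ a - k then 1 else 0) =
      s.r c - (if c ≤ b then 1 else 0) + (if c ≤ b - k then 1 else 0) := by
    intro c
    rw [← move_r hk ha, ← move_r hk hb, h]
  rcases lt_or_gt_of_ne hk with h0 | h0
  · have k3 := key (a - k)
    have k4 := key (b - k)
    rw [if_neg (by omega), if_pos (by omega)] at k3
    rw [if_neg (show ¬ b - k ≤ b by omega), if_pos (show b - k ≤ b - k by omega)] at k4
    have t1 : a ≤ b := by split_ifs at k3 <;> omega
    have t2 : b ≤ a := by split_ifs at k4 <;> omega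
    omega
  · have k1 := key a
    have k2 := key b
    rw [if_pos (by omega), if_neg (by omega)] at k1
    rw [if_pos (show b ≤ b by omega), if_neg (show ¬ b ≤ b - k by omega)] at k2
    have t1 : a ≤ b := by split_ifs at k1 <;> omega
    have t2 : b ≤ a := by split_ifs at k2 <;> omega
    omega

/-- The hook relation for both signs of `k`. -/
def hookRel (k : ℤ) (lam mu : YoungDiagram) : Prop :=
  if 0 < k then hookStep k.toNat mu lam else hookStep (-k).toNat lam mu

/-- The hook sign for both signs of `k`. -/
noncomputable def hookSgn (k : ℤ) (lam mu : YoungDiagram) : ℂ :=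
  if 0 < k then (-1 : ℂ) ^ skewL (lam.cells \ mu.cells)
  else (-1 : ℂ) ^ skewL (mu.cells \ lam.cells)

theorem LamTarget_eq {k : ℤ} (hk : k ≠ 0) (lam : YoungDiagram) :
    LamTarget k lam = ∑ᶠ mu : YoungDiagram, if hookRel k lam mu then
      (hookSgn k lam mu) • Finsupp.single mu (1 : ℂ) else 0 := by
  unfold LamTarget hookRel hookSgn
  by_cases h : 0 < k
  · simp only [if_pos h]
  · simp only [if_neg h, if_pos (show k < 0 by omega)]

theorem hookRel_forward {k : ℤ} (hk : k ≠ 0) {lam mu : YoungDiagram} (h : hookRel k lam mu) :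
    ∃ a, canMove k (toMaya lam) a ∧ toMaya mu = ((toMaya lam).down a).up (a - k) := by
  unfold hookRel at h
  by_cases hk0 : 0 < k
  · rw [if_pos hk0] at h
    obtain ⟨p, hp⟩ := hookStep_forward h
    have hkk : ((k.toNat : ℕ) : ℤ) = k := by omega
    rw [hkk] at hp
    have hc : canMove k (toMaya lam) (p + k) := by
      have s1 := rfun_step mu (p + k)
      have s2 := rfun_step lam (p + k)
      have s3 := rfun_step mu p
      have s4 := rfun_step lam p
      have h1 := hp (p + k)
      have h2 := hp (p + k + 1)
      have h3 := hp p
      have h4 := hp (p + 1)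
      rw [if_pos (by omega)] at h1 h4
      rw [if_neg (by omega)] at h2 h3
      constructor
      · show (rfun lam (p + k) : ℤ) = rfun lam (p + k + 1) + 1
        omega
      · rw [show p + k - k = p by ring]
        show (rfun lam p : ℤ) = rfun lam (p + 1)
        omega
    refine ⟨p + k, hc, Maya.ext' fun c => ?_⟩
    rw [move_r hk hc]
    show (rfun mu c : ℤ) = rfun lam c - _ + _
    rw [hp]
    split_ifs <;> push_cast <;> omega
  · rw [if_neg hk0] at h
    obtain ⟨p, hp⟩ := hookStep_forward h
    have hkk : (((-k).toNat : ℕ) : ℤ) = -k := by omega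
    rw [hkk] at hp
    have hc : canMove k (toMaya lam) p := by
      have s1 := rfun_step mu (p - k)
      have s2 := rfun_step lam (p - k)
      have s3 := rfun_step mu p
      have s4 := rfun_step lam p
      have h1 := hp (p - k)
      have h2 := hp (p - k + 1)
      have h3 := hp p
      have h4 := hp (p + 1)
      rw [if_pos (by omega)] at h1 h4
      rw [if_neg (by omega)] at h2 h3
      constructor
      · show (rfun lam p : ℤ) = rfun lam (p + 1) + 1
        omega
      · show (rfun lam (p - k) : ℤ) = rfun lam (p - k + 1)
        omega
    refine ⟨p, hc, Maya.ext' fun c => ?_⟩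
    rw [move_r hk hc]
    show (rfun mu c : ℤ) = rfun lam c - _ + _
    rw [hp]
    split_ifs <;> push_cast <;> omega

theorem sgn_sub_eq_add (m n : ℤ) : (-1 : ℂ) ^ (m - n) = (-1 : ℂ) ^ (n + m) := by
  have : m - n = (n + m) - 2 * n := by ring
  rw [this, zpow_sub₀ (by norm_num), zpow_mul]
  simp

theorem hookRel_backward {k : ℤ} (hk : k ≠ 0) {lam mu : YoungDiagram} {a : ℤ}
    (h : canMove k (toMaya lam) a) (e : toMaya mu = ((toMaya lam).down a).up (a - k)) :
    hookRel k lam mu ∧ hookSgn k lam mu =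
      (-1 : ℂ) ^ ((toMaya lam).r (a + 1) + ((toMaya lam).down a).r (a - k + 1)) := by
  have hr : ∀ c, (rfun mu c : ℤ) =
      rfun lam c - (if c ≤ a then 1 else 0) + (if c ≤ a - k then 1 else 0) := by
    intro c
    have := move_r hk h c
    rw [← e] at this
    exact this
  have c1 : (rfun lam a : ℤ) = rfun lam (a + 1) + 1 := h.1
  have c2 : (rfun lam (a - k) : ℤ) = rfun lam (a - k + 1) := h.2
  rw [Maya.down_r h.1]
  show _ ∧ _ = (-1 : ℂ) ^ ((rfun lam (a + 1) : ℤ) + (rfun lam (a - k + 1) - _))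
  unfold hookRel hookSgn
  by_cases hk0 : 0 < k
  · rw [if_pos hk0, if_pos hk0, if_pos (by omega)]
    have hkk : ((k.toNat : ℕ) : ℤ) = k := by omega
    obtain ⟨t1, t2⟩ := hookStep_backward (k := k.toNat) (mu := mu) (lam := lam) (p := a - k)
      (by omega) (by
        intro c
        have := hr c
        rw [hkk]
        split_ifs at this ⊢ <;> omega)
    refine ⟨t1, ?_⟩
    rw [← zpow_natCast, t2, hkk, sgn_sub_eq_add]
    congr 1
    have r1 := hr (a - k + 1)
    have r2 := hr a
    rw [if_pos (by omega), if_neg (by omega)] at r1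
    rw [if_pos (by omega), if_neg (by omega)] at r2
    rw [show a - k + k = a by ring]
    omega
  · rw [if_neg hk0, if_neg hk0, if_neg (by omega)]
    have hkk : (((-k).toNat : ℕ) : ℤ) = -k := by omega
    obtain ⟨t1, t2⟩ := hookStep_backward (k := (-k).toNat) (mu := lam) (lam := mu) (p := a)
      (by omega) (by
        intro c
        have := hr c
        rw [hkk]
        split_ifs at this ⊢ <;> omega)
    refine ⟨t1, ?_⟩
    rw [← zpow_natCast, t2, hkk, sgn_sub_eq_add]
    congr 1
    rw [← sub_eq_add_neg]
    omega

open Filter in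
theorem Phi_LamTarget {k : ℤ} (hk : k ≠ 0) (lam : YoungDiagram) : ∀ᶠ N : ℤ in atTop,
    Phi (LamTarget k lam) =
      ∑ a ∈ Finset.Icc (-N) N, EE (a - k) a (Finsupp.single (toMaya lam) 1) := by
  have hsm : ∀ᶠ N : ℤ in atTop, ∀ a, canMove k (toMaya lam) a → a ∈ Finset.Icc (-N) N := by
    filter_upwards [EE_small k (Finsupp.single (toMaya lam) 1)] with N hN a ha
    have hne : EE (a - k) a (Finsupp.single (toMaya lam) 1) ≠ 0 := by
      rw [EE_single hk, if_pos ha]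
      refine smul_ne_zero (zpow_ne_zero _ (by norm_num)) ?_
      rw [Ne, Finsupp.single_eq_zero]
      exact one_ne_zero
    rw [Finset.mem_Icc]
    constructor
    · by_contra hc
      exact hne (by rw [(hN a).1 (by omega), if_neg hk])
    · by_contra hc
      exact hne ((hN a).2 (by omega))
  filter_upwards [hsm] with N hN
  have hex : ∀ a, ∃ mu, canMove k (toMaya lam) a →
      toMaya mu = ((toMaya lam).down a).up (a - k) := by
    intro a
    by_cases h : canMove k (toMaya lam) a
    · obtain ⟨mu, hmu⟩ := move_exists hk h
      exact ⟨mu, fun _ => hmu⟩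
    · exact ⟨lam, fun h' => absurd h' h⟩
  choose g hg using hex
  rw [LamTarget_eq hk, finsum_eq_sum_of_support_subset
    (s := ((Finset.Icc (-N) N).filter (canMove k (toMaya lam))).image g)]
  · rw [Finset.sum_image, map_sum, Finset.sum_filter]
    · apply Finset.sum_congr rfl
      intro a _
      rw [EE_single hk]
      by_cases h : canMove k (toMaya lam) a
      · obtain ⟨h1, h2⟩ := hookRel_backward hk h (hg a h)
        rw [if_pos h, if_pos h, if_pos h1, h2, map_smul, Phi_single, hg a h]
      · rw [if_neg h, if_neg h]
    · intro a ha b hb hab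
      rw [Finset.mem_coe, Finset.mem_filter] at ha hb
      exact move_inj hk ha.2 hb.2 (by rw [← hg a ha.2, ← hg b hb.2, hab])
  · intro mu hmu
    have hmu2 : hookRel k lam mu := by
      by_contra hc
      exact hmu (if_neg hc)
    obtain ⟨a, h1, h2⟩ := hookRel_forward hk hmu2
    rw [Finset.mem_coe, Finset.mem_image]
    refine ⟨a, Finset.mem_filter.2 ⟨hN a h1, h1⟩, toMaya_injective ?_⟩
    rw [h2, hg a h1]

theorem Lam_single (k : ℤ) (lam : YoungDiagram) (x : ℂ) :
    Lam k (Finsupp.single lam x) = x • LamTarget k lam := by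
  rw [Lam, Finsupp.lsum_single]
  rfl

open Filter in
theorem Phi_Lam {k : ℤ} (hk : k ≠ 0) (v : FermionicFock) : ∀ᶠ N : ℤ in atTop,
    Phi (Lam k v) = ∑ a ∈ Finset.Icc (-N) N, EE (a - k) a (Phi v) := by
  induction v using Finsupp.induction_linear with
  | zero => simp
  | add f g hf hg =>
    filter_upwards [hf, hg] with N h1 h2
    simp only [map_add, h1, h2, Finset.sum_add_distrib]
  | single s x =>
    filter_upwards [Phi_LamTarget hk s] with N h
    have hx : (Finsupp.single (toMaya s) x : MFock) =
        x • Finsupp.single (toMaya s) (1 : ℂ) := by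
      rw [Finsupp.smul_single, smul_eq_mul, mul_one]
    rw [Lam_single, map_smul, h, Finset.smul_sum, Phi_single, hx]
    simp only [map_smul]

theorem double_sum_comm (n m : ℤ) (I : Finset ℤ) (w : MFock) :
    (∑ a ∈ I, ∑ b ∈ I, EE (a - n) a (EE (b - m) b w)) +
      ∑ a ∈ I, (if a - n ∈ I then EE (a - n - m) a w else 0) =
    (∑ b ∈ I, ∑ a ∈ I, EE (b - m) b (EE (a - n) a w)) +
      ∑ b ∈ I, (if b - m ∈ I then EE (b - m - n) b w else 0) := by
  have h1 : ∑ a ∈ I, (if a - n ∈ I then EE (a - n - m) a w else 0) =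
      ∑ a ∈ I, ∑ b ∈ I, (if b = a - n then EE (b - m) a w else 0) := by
    apply Finset.sum_congr rfl
    intro a _
    rw [Finset.sum_ite_eq']
  have h2 : ∑ b ∈ I, (if b - m ∈ I then EE (b - m - n) b w else 0) =
      ∑ b ∈ I, ∑ a ∈ I, (if a = b - m then EE (a - n) b w else 0) := by
    apply Finset.sum_congr rfl
    intro a _
    rw [Finset.sum_ite_eq']
  rw [h1, h2, Finset.sum_comm (s := I) (t := I) (f := fun b a => EE (b - m) b (EE (a - n) a w)),
    Finset.sum_comm (s := I) (t := I) (f := fun b a => if a = b - m then EE (a - n) b w else 0),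
    ← Finset.sum_add_distrib, ← Finset.sum_add_distrib]
  apply Finset.sum_congr rfl
  intro a _
  rw [← Finset.sum_add_distrib, ← Finset.sum_add_distrib]
  apply Finset.sum_congr rfl
  intro b _
  have := congrArg (fun f : Module.End ℂ MFock => f w) (EE_comm (a - n) a (b - m) b)
  simp only [LinearMap.add_apply, Module.End.mul_apply] at this
  have h4 : ∀ (P : Prop) [Decidable P] (x y : ℤ),
      (if P then EE x y else 0) w = if P then EE x y w else 0 := by
    intro P _ x y
    split_ifs <;> rfl
  rw [h4, h4] at this
  exact this

open Filter in
theorem Phi_Lam_Lam {n m : ℤ} (hn : n ≠ 0) (hm : m ≠ 0) (v : FermionicFock) :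
    ∀ᶠ N : ℤ in atTop, Phi (Lam n (Lam m v)) = ∑ a ∈ Finset.Icc (-N) N,
      ∑ b ∈ Finset.Icc (-N) N, EE (a - n) a (EE (b - m) b (Phi v)) := by
  filter_upwards [Phi_Lam hn (Lam m v), Phi_Lam hm v] with N h1 h2
  rw [h1, h2]
  simp only [map_sum]

open Filter in
theorem Lam_comm_apply {n m : ℤ} (hn : n ≠ 0) (hm : m ≠ 0) (hnm : n + m ≠ 0)
    (v : FermionicFock) : Lam n (Lam m v) = Lam m (Lam n v) := by
  obtain ⟨N0, h0⟩ := (EE_small (n + m) (Phi v)).exists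
  obtain ⟨N, h1, h2, hN⟩ := ((Phi_Lam_Lam hn hm v).and ((Phi_Lam_Lam hm hn v).and
    (eventually_ge_atTop (N0 + |n| + |m|)))).exists
  have b1 := le_abs_self n
  have b2 := neg_abs_le n
  have b3 := le_abs_self m
  have b4 := neg_abs_le m
  apply Phi_injective
  rw [h1, h2]
  have key := double_sum_comm n m (Finset.Icc (-N) N) (Phi v)
  have e1 : ∀ x y : ℤ, x + y = n + m → |x| ≤ |n| + |m| → ∀ a,
      (if a - x ∈ Finset.Icc (-N) N then EE (a - x - y) a (Phi v) else 0) =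
        EE (a - (n + m)) a (Phi v) := by
    intro x y hxy hx a
    split_ifs with h
    · rw [sub_sub, hxy]
    · have b5 := le_abs_self x
      have b6 := neg_abs_le x
      rw [Finset.mem_Icc] at h
      by_cases ha : N0 < a
      · rw [(h0 a).2 ha]
      · rw [(h0 a).1 (by omega), if_neg hnm]
  simp only [e1 n m rfl (by have := abs_nonneg m; omega),
    e1 m n (add_comm m n) (by have := abs_nonneg n; omega)] at key
  exact add_right_cancel key

open Filter in
theorem Lam_comm_self_apply {k : ℤ} (hk : 0 < k) (v : FermionicFock) :
    Lam k (Lam (-k) v) = (k : ℂ) • v + Lam (-k) (Lam k v) := by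
  obtain ⟨N0, h0⟩ := (EE_small 0 (Phi v)).exists
  obtain ⟨N, h1, h2, hN, hN'⟩ := ((Phi_Lam_Lam (n := k) (m := -k) (by omega) (by omega) v).and
    ((Phi_Lam_Lam (n := -k) (m := k) (by omega) (by omega) v).and
    ((eventually_ge_atTop (N0 + k)).and (eventually_ge_atTop k)))).exists
  apply Phi_injective
  rw [map_add, h1, h2, map_smul]
  have key := double_sum_comm k (-k) (Finset.Icc (-N) N) (Phi v)
  have e1 : ∑ b ∈ Finset.Icc (-N) N,
      (if b - -k ∈ Finset.Icc (-N) N then EE (b - -k - k) b (Phi v) else 0) =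
      (k : ℂ) • Phi v + ∑ a ∈ Finset.Icc (-N) N,
        (if a - k ∈ Finset.Icc (-N) N then EE (a - k - -k) a (Phi v) else 0) := by
    have e2 : (k : ℂ) • Phi v = ∑ a ∈ Finset.Icc (-N) N, if a < -N + k then Phi v else 0 := by
      have hf : (Finset.Icc (-N) N).filter (fun a => a < -N + k) = Finset.Ico (-N) (-N + k) := by
        ext x
        simp only [Finset.mem_filter, Finset.mem_Icc, Finset.mem_Ico]
        omega
      rw [← Finset.sum_filter, hf, Finset.sum_const, Int.card_Ico, ← Nat.cast_smul_eq_nsmul ℂ]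
      congr 1
      have : ((-N + k - -N).toNat : ℤ) = k := by omega
      exact_mod_cast this.symm
    rw [e2, ← Finset.sum_add_distrib]
    apply Finset.sum_congr rfl
    intro a ha
    have z1 : a - -k - k = a - 0 := by ring
    have z2 : a - k - -k = a - 0 := by ring
    rw [z1, z2]
    simp only [Finset.mem_Icc] at ha ⊢
    by_cases c1 : a < -N + k
    · rw [if_pos (by omega), if_pos c1, if_neg (by omega), (h0 a).1 (by omega), if_pos rfl]
      exact (add_zero _).symm
    · rw [if_neg c1, if_pos (show -N ≤ a - k ∧ a - k ≤ N by omega)]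
      refine Eq.trans ?_ (zero_add _).symm
      split_ifs with c2
      · rfl
      · rw [(h0 a).2 (by omega)]
  rw [e1, ← add_assoc] at key
  have key2 := add_right_cancel key
  rw [key2, add_comm]

/-- On the fermionic Fock space, the operators `Λ_k` (`k ≠ 0`) satisfy the Heisenberg
commutation relations: `[Λ_n, Λ_m] = 0` for `n, m ≠ 0` with `n + m ≠ 0`, and
`[Λ_k, Λ_{−k}] = k · id` for `k > 0`. -/
theorem fermionic_fock_heisenberg_relations :
    (∀ k m : ℤ, k ≠ 0 → m ≠ 0 → k + m ≠ 0 → Lam k * Lam m = Lam m * Lam k) ∧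
    (∀ k : ℤ, 0 < k →
      Lam k * Lam (-k) - Lam (-k) * Lam k =
        ((k : ℂ) • (1 : Module.End ℂ FermionicFock))) := by

  constructor
  · intro k m hk hm hkm
    apply LinearMap.ext
    intro v
    exact Lam_comm_apply hk hm hkm v
  · intro k hk
    apply LinearMap.ext
    intro v
    exact sub_eq_of_eq_add (Lam_comm_self_apply hk v)
end

section
/- The fermionic Fock space ℱ is irreducible under the Heisenberg operators: any ℂ-subspace of ℱ that is invariant under all the operators Λ_k (k a nonzero integer) is either 0 or all of ℱ. -/
open scoped Classical

/-! ### Polynomial part -/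

namespace FockAux

open Finset MvPolynomial

lemma esymm_mem (N : ℕ) (I : Ideal (MvPolynomial (Fin N) ℂ))
    (hI : ∀ k, 1 ≤ k → psum (Fin N) ℂ k ∈ I) (k : ℕ) (hk : 1 ≤ k) :
    esymm (Fin N) ℂ k ∈ I := by
  have h := mul_esymm_eq_sum (Fin N) ℂ k
  have h2 : (k : MvPolynomial (Fin N) ℂ) * esymm (Fin N) ℂ k ∈ I := by
    rw [h]
    apply Ideal.mul_mem_left
    apply Ideal.sum_mem
    intro a ha
    apply Ideal.mul_mem_left
    apply hI
    simp only [mem_filter, HasAntidiagonal.mem_antidiagonal] at ha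
    omega
  have h3 : esymm (Fin N) ℂ k
      = C ((k : ℂ)⁻¹) * ((k : MvPolynomial (Fin N) ℂ) * esymm (Fin N) ℂ k) := by
    have h4 : (k : MvPolynomial (Fin N) ℂ) = C (k : ℂ) := by simp
    have h5 : (k : ℂ) ≠ 0 := by exact_mod_cast (by omega : k ≠ 0)
    rw [← mul_assoc, h4, ← C_mul, inv_mul_cancel₀ h5]
    simp
  rw [h3]
  exact Ideal.mul_mem_left _ _ h2

lemma X_pow_mem (N : ℕ) (I : Ideal (MvPolynomial (Fin N) ℂ))
    (hI : ∀ k, 1 ≤ k → psum (Fin N) ℂ k ∈ I) (i : Fin N) :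
    (X i : MvPolynomial (Fin N) ℂ) ^ N ∈ I := by
  have h := MvPolynomial.prod_C_add_X_eq_sum_esymm ℂ (Fin N)
  have h1 := congrArg (Polynomial.eval (-(X i : MvPolynomial (Fin N) ℂ))) h
  rw [Polynomial.eval_prod, Finset.prod_eq_zero (mem_univ i) (by simp),
    Polynomial.eval_finsetSum, Finset.sum_range_succ'] at h1
  simp only [Polynomial.eval_mul, Polynomial.eval_C, Polynomial.eval_pow, Polynomial.eval_X,
    Fintype.card_fin, esymm_zero, one_mul, Nat.sub_zero] at h1
  have h2 : (-(X i : MvPolynomial (Fin N) ℂ)) ^ N ∈ I := by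
    have : (-(X i : MvPolynomial (Fin N) ℂ)) ^ N = - ∑ k ∈ range N,
        esymm (Fin N) ℂ (k + 1) * (-(X i : MvPolynomial (Fin N) ℂ)) ^ (N - (k + 1)) := by
      linear_combination -h1
    rw [this]
    apply neg_mem
    apply Ideal.sum_mem
    intro k _
    exact Ideal.mul_mem_right _ _ (esymm_mem N I hI _ (by omega))
  rw [neg_pow] at h2
  have := Ideal.mul_mem_left I ((-1) ^ N) h2
  rwa [← mul_assoc, ← mul_pow, neg_mul_neg, one_mul, one_pow, one_mul] at this

/-- A function on exponents satisfying the power sum relations vanishes at large exponents. -/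
lemma vanish_of_psum (N : ℕ) (W : (Fin N → ℕ) → ℂ)
    (hW : ∀ k, 1 ≤ k → ∀ α : Fin N → ℕ, ∑ i, W (α + Pi.single i k) = 0)
    (α : Fin N → ℕ) (i : Fin N) (hi : N ≤ α i) : W α = 0 := by
  let Φ : MvPolynomial (Fin N) ℂ →ₗ[ℂ] ℂ :=
    (basisMonomials (Fin N) ℂ).constr ℂ (fun s => W s)
  have hΦ : ∀ s : Fin N →₀ ℕ, Φ (monomial s 1) = W s := by
    intro s
    have := (basisMonomials (Fin N) ℂ).constr_basis ℂ (fun s => W s) s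
    simpa [Φ] using this
  have hps : ∀ k, 1 ≤ k → ∀ q, Φ (q * psum (Fin N) ℂ k) = 0 := by
    intro k hk q
    induction q using MvPolynomial.induction_on' with
    | monomial s c =>
      have : monomial s c = c • (monomial s (1 : ℂ)) := by simp [smul_monomial]
      rw [this, smul_mul_assoc, map_smul, psum, mul_sum, map_sum]
      have h2 : ∀ j : Fin N, Φ (monomial s 1 * X j ^ k) = W ((s : Fin N → ℕ) + Pi.single j k) := by
        intro j
        rw [X_pow_eq_monomial, monomial_mul, one_mul, hΦ]
        congr 1
        ext x
        simp [Finsupp.single_apply, Pi.single_apply, eq_comm]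
      rw [Finset.sum_congr rfl (fun j _ => h2 j), hW k hk, smul_zero]
    | add p q hp hq => rw [add_mul, map_add, hp, hq, add_zero]
  let I : Ideal (MvPolynomial (Fin N) ℂ) :=
    { carrier := {q | ∀ r, Φ (r * q) = 0}
      add_mem' := by
        intro a b ha hb r
        rw [mul_add, map_add, ha, hb, add_zero]
      zero_mem' := by intro r; simp
      smul_mem' := by
        intro c x hx r
        rw [smul_eq_mul, ← mul_assoc]
        exact hx _ }
  have hI : ∀ k, 1 ≤ k → psum (Fin N) ℂ k ∈ I := fun k hk => hps k hk
  have hX : ∀ r, Φ (r * X i ^ N) = 0 := X_pow_mem N I hI i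
  let s : Fin N →₀ ℕ := Finsupp.equivFunOnFinite.symm (α - Pi.single i N)
  have := hX (monomial s 1)
  rw [X_pow_eq_monomial, monomial_mul, one_mul, hΦ] at this
  rw [← this]
  congr 1
  ext x
  by_cases hx : x = i
  · subst hx; simp [s]; omega
  · have : ¬ i = x := fun h => hx h.symm
    simp [s, hx]

/-! ### Sign part -/

/-- Sign of the Vandermonde determinant. -/
noncomputable def sg {N : ℕ} (α : Fin N → ℕ) : ℤ :=
  Int.sign (Matrix.vandermonde (fun i => (α i : ℤ))).det

lemma sg_eq_zero {N : ℕ} {α : Fin N → ℕ} (h : ¬ Function.Injective α) : sg α = 0 := by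
  rw [sg, Int.sign_eq_zero_iff_zero]
  by_contra h2
  rw [← ne_eq, Matrix.det_vandermonde_ne_zero_iff] at h2
  exact h (fun a b hab => h2 (by simp [hab]))

lemma sg_mul_self {N : ℕ} {α : Fin N → ℕ} (h : Function.Injective α) : sg α * sg α = 1 := by
  have : (Matrix.vandermonde (fun i => (α i : ℤ))).det ≠ 0 := by
    rw [Matrix.det_vandermonde_ne_zero_iff]
    intro a b hab
    exact h (by simpa using hab)
  rw [sg]
  rcases lt_or_gt_of_ne this with h | h
  · rw [Int.sign_eq_neg_one_of_neg h]; rfl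
  · rw [Int.sign_eq_one_of_pos h]; rfl

lemma sg_swap {N : ℕ} (α : Fin N → ℕ) {i j : Fin N} (h : i ≠ j) :
    sg (α ∘ Equiv.swap i j) = - sg α := by
  have := Matrix.det_permute (Equiv.swap i j) (Matrix.vandermonde (fun i => (α i : ℤ)))
  rw [Equiv.Perm.sign_swap h] at this
  rw [sg, sg, ← Int.sign_neg]
  congr 1
  have e : (Matrix.vandermonde (fun x => (((α ∘ Equiv.swap i j) x : ℕ) : ℤ))) =
    (Matrix.vandermonde (fun i => (α i : ℤ))).submatrix (Equiv.swap i j) id := by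
    ext a b
    simp [Matrix.vandermonde]
  rw [e, this]
  simp

lemma int_sign_prod {ι : Type*} (s : Finset ι) (f : ι → ℤ) :
    Int.sign (∏ i ∈ s, f i) = ∏ i ∈ s, Int.sign (f i) := by
  classical
  induction s using Finset.induction_on with
  | empty => simp
  | insert a s ha ih => rw [prod_insert ha, prod_insert ha, Int.sign_mul, ih]

lemma sg_ratio {N : ℕ} (α : Fin N → ℕ) (h : Function.Injective α) (i : Fin N) (k : ℕ) :
    sg (α + Pi.single i k) = sg α * ∏ j ∈ univ.erase i,
      (Int.sign ((α i : ℤ) + k - α j) * Int.sign ((α i : ℤ) - α j)) := by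
  have key : sg (α + Pi.single i k) * sg α = ∏ j ∈ univ.erase i,
      (Int.sign ((α i : ℤ) + k - α j) * Int.sign ((α i : ℤ) - α j)) := by
    set r : Fin N → ℤ :=
      fun j => Int.sign ((α i : ℤ) + k - α j) * Int.sign ((α i : ℤ) - α j) with hr
    rw [sg, sg, Matrix.det_vandermonde, Matrix.det_vandermonde, int_sign_prod, int_sign_prod,
      ← prod_mul_distrib]
    simp only [int_sign_prod, ← prod_mul_distrib]
    have h1 : ∀ p : Fin N, ∏ q ∈ Ioi p, (Int.sign ((((α + Pi.single i k : Fin N → ℕ) q : ℕ) : ℤ)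
        - ((α + Pi.single i k : Fin N → ℕ) p : ℕ)) * Int.sign ((α q : ℤ) - α p)) =
        if p = i then ∏ q ∈ Ioi i, r q else if p < i then r p else 1 := by
      intro p
      split_ifs with hp hp2
      · subst hp
        apply prod_congr rfl
        intro q hq
        have hq' : q ≠ p := (ne_of_gt (mem_Ioi.1 hq))
        simp only [hr, Pi.add_apply, Pi.single_apply, hq', if_false, if_true, add_zero]
        rw [← neg_sub, Int.sign_neg, ← neg_sub (α p : ℤ), Int.sign_neg, neg_mul_neg]
        push_cast
        rfl
      · rw [prod_eq_single i]
        · simp [hr, hp]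
        · intro q hq hqi
          have hq' : q ≠ p := (ne_of_gt (mem_Ioi.1 hq))
          have : (α q : ℤ) - α p ≠ 0 := by
            rw [sub_ne_zero]
            intro hh
            exact hq' (h (by exact_mod_cast hh))
          simp only [Pi.add_apply, Pi.single_apply, hqi, hp, if_false, add_zero]
          rcases lt_or_gt_of_ne this with h | h
          · rw [Int.sign_eq_neg_one_of_neg h]; rfl
          · rw [Int.sign_eq_one_of_pos h]; rfl
        · intro hh
          exact absurd (mem_Ioi.2 hp2) hh
      · apply prod_eq_one
        intro q hq
        have hq' : q ≠ p := (ne_of_gt (mem_Ioi.1 hq))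
        have hqi : q ≠ i := by
          rintro rfl
          exact hp2 (mem_Ioi.1 hq)
        have : (α q : ℤ) - α p ≠ 0 := by
          rw [sub_ne_zero]
          intro hh
          exact hq' (h (by exact_mod_cast hh))
        simp only [Pi.add_apply, Pi.single_apply, hqi, hp, if_false, add_zero]
        rcases lt_or_gt_of_ne this with h | h
        · rw [Int.sign_eq_neg_one_of_neg h]; rfl
        · rw [Int.sign_eq_one_of_pos h]; rfl
    rw [prod_congr rfl (fun p _ => h1 p)]
    rw [← mul_prod_erase univ _ (mem_univ i), if_pos rfl]
    have h2 : ∏ x ∈ univ.erase i, (if x = i then ∏ q ∈ Ioi i, r q else if x < i then r x else 1)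
        = ∏ x ∈ Iio i, r x := by
      rw [prod_congr rfl (g := fun x => if x < i then r x else 1)
        (fun x hx => by rw [if_neg (ne_of_mem_erase hx)]), ← prod_filter]
      apply prod_congr _ (fun _ _ => rfl)
      ext x
      simp only [mem_filter, mem_erase, mem_univ, and_true, mem_Iio]
      exact ⟨fun h => h.2, fun h => ⟨ne_of_lt h, h⟩⟩
    rw [h2, ← prod_union]
    · apply prod_congr _ (fun _ _ => rfl)
      ext x
      simp only [mem_union, mem_Ioi, mem_Iio, mem_erase, mem_univ, and_true]
      constructor
      · rintro (h | h)
        · exact ne_of_gt h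
        · exact ne_of_lt h
      · intro h
        rcases lt_or_gt_of_ne h with h | h
        · exact Or.inr h
        · exact Or.inl h
    · rw [Finset.disjoint_left]
      intro x hx hx2
      simp only [mem_Ioi, mem_Iio] at hx hx2
      exact lt_asymm hx hx2
  rw [← key, mul_comm (sg (α + _)), ← mul_assoc, sg_mul_self h, one_mul]

lemma prod_sign_eq {N : ℕ} (α : Fin N → ℕ) (h : Function.Injective α) (i : Fin N) (k : ℕ)
    (hk : 1 ≤ k) :
    ∏ j ∈ univ.erase i, (Int.sign ((α i : ℤ) + k - α j) * Int.sign ((α i : ℤ) - α j))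
    = if α i + k ∈ univ.image α then 0
      else (-1) ^ ((univ.image α).filter (fun s => α i < s ∧ s < α i + k)).card := by
  split_ifs with hm
  · simp only [mem_image, mem_univ, true_and] at hm
    obtain ⟨j, hj⟩ := hm
    apply prod_eq_zero (i := j)
    · rw [mem_erase]
      refine ⟨?_, mem_univ _⟩
      rintro rfl
      omega
    · rw [hj]; simp
  · have hm' : ∀ j, α j ≠ α i + k := by
      intro j hj
      exact hm (mem_image.2 ⟨j, mem_univ _, hj⟩)
    have h1 : ∀ j ∈ univ.erase i,
        (Int.sign ((α i : ℤ) + k - α j) * Int.sign ((α i : ℤ) - α j)) =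
        if (α i < α j ∧ α j < α i + k) then -1 else 1 := by
      intro j hj
      have hne : α j ≠ α i := fun hh => (ne_of_mem_erase hj) (h hh)
      have := hm' j
      split_ifs with hc
      · rw [Int.sign_eq_one_of_pos (by omega), Int.sign_eq_neg_one_of_neg (by omega)]; rfl
      · by_cases h2 : α j < α i
        · rw [Int.sign_eq_one_of_pos (by omega), Int.sign_eq_one_of_pos (by omega)]; rfl
        · rw [Int.sign_eq_neg_one_of_neg (by omega), Int.sign_eq_neg_one_of_neg (by omega)]; rfl
    rw [prod_congr rfl h1, ← prod_filter, prod_const]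
    congr 1
    rw [filter_image, card_image_of_injective _ h]
    congr 1
    ext x
    simp only [mem_filter, mem_erase, mem_univ, and_true, true_and, and_iff_right_iff_imp]
    rintro ⟨h1, _⟩ rfl
    exact lt_irrefl _ h1

/-- The alternating extension of a function of finite sets. -/
noncomputable def Wf {N : ℕ} (u : Finset ℕ → ℂ) (α : Fin N → ℕ) : ℂ :=
  (sg α : ℂ) * u (univ.image α)

lemma image_add_single {N : ℕ} (α : Fin N → ℕ) (h : Function.Injective α) (i : Fin N) (k : ℕ) :
    univ.image (α + Pi.single i k) = insert (α i + k) ((univ.image α).erase (α i)) := by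
  ext x
  simp only [mem_image, mem_univ, true_and, mem_insert, mem_erase, Pi.add_apply, Pi.single_apply]
  constructor
  · rintro ⟨j, rfl⟩
    by_cases hj : j = i
    · subst hj; simp
    · right
      simp only [hj, if_false, add_zero]
      exact ⟨fun hh => hj (h hh), j, rfl⟩
  · rintro (rfl | ⟨hx, j, rfl⟩)
    · exact ⟨i, by simp⟩
    · refine ⟨j, ?_⟩
      have : j ≠ i := by rintro rfl; exact hx rfl
      simp [this]

lemma sum_Wf_inj {N : ℕ} (u : Finset ℕ → ℂ) (α : Fin N → ℕ) (h : Function.Injective α)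
    (k : ℕ) (hk : 1 ≤ k) :
    ∑ i, Wf u (α + Pi.single i k) = sg α *
      ∑ a ∈ (univ.image α).filter (fun a => a + k ∉ univ.image α),
        (-1 : ℂ) ^ ((univ.image α).filter (fun s => a < s ∧ s < a + k)).card *
          u (insert (a + k) ((univ.image α).erase a)) := by
  rw [sum_filter, sum_image (fun a _ b _ hab => h hab), mul_sum]
  apply sum_congr rfl
  intro i _
  rw [Wf, sg_ratio α h, prod_sign_eq α h i k hk, image_add_single α h]
  by_cases hm : α i + k ∈ univ.image α
  · simp only [hm, if_true, not_true, if_false]; simp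
  · simp only [hm, if_false, not_false_eq_true, if_true]
    push_cast
    ring

lemma sum_Wf_not_inj {N : ℕ} (u : Finset ℕ → ℂ) (α : Fin N → ℕ) (h : ¬ Function.Injective α)
    (k : ℕ) :
    ∑ i, Wf u (α + Pi.single i k) = 0 := by
  simp only [Function.Injective, not_forall] at h
  obtain ⟨i, j, hij, hne⟩ := h
  have hother : ∀ l, l ≠ i ∧ l ≠ j → Wf u (α + Pi.single l k) = 0 := by
    rintro l ⟨h1, h2⟩
    rw [Wf, sg_eq_zero]
    · simp
    · intro hinj
      apply hne
      apply hinj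
      simp [h1.symm, h2.symm, hij]
  rw [Fintype.sum_eq_add i j hne hother]
  have e : α + Pi.single j k = (α + Pi.single i k) ∘ Equiv.swap i j := by
    ext x
    simp only [Pi.add_apply, Function.comp]
    by_cases hx : x = i
    · subst hx; simp [hij, hne]
    · by_cases hx2 : x = j
      · subst hx2; simp [hij]
      · rw [Equiv.swap_apply_of_ne_of_ne hx hx2]; simp [hx, hx2]
  have e2 : univ.image (α + Pi.single j k) = univ.image (α + Pi.single i k) := by
    rw [e, ← image_image]
    congr 1
    exact image_univ_of_surjective (Equiv.surjective _)
  rw [Wf, Wf, e2, e, sg_swap _ hne]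
  push_cast
  ring

end FockAux

/-! ### Bead sets of Young diagrams and hooks -/

namespace FockAux

open Finset

/-- The `i`-th bead of a diagram with at most `N` rows. -/
def bd (N : ℕ) (ν : YoungDiagram) (i : ℕ) : ℕ := ν.rowLen i + (N - 1 - i)

/-- At most `N` rows. -/
def RN (N : ℕ) (ν : YoungDiagram) : Prop := ∀ i, N ≤ i → ν.rowLen i = 0

/-- The bead set. -/
def beads (N : ℕ) (ν : YoungDiagram) : Finset ℕ := (range N).image (bd N ν)

/-- Number of elements at least `x`. -/
def cnt (S : Finset ℕ) (x : ℕ) : ℕ := (S.filter (fun s => x ≤ s)).card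

lemma bd_lt {N : ℕ} (ν : YoungDiagram) {i j : ℕ} (hij : i < j) (hj : j < N) :
    bd N ν j < bd N ν i := by
  have := ν.rowLen_anti i j hij.le
  unfold bd
  omega

lemma bd_inj {N : ℕ} (ν : YoungDiagram) {i j : ℕ} (hi : i < N) (hj : j < N)
    (h : bd N ν i = bd N ν j) : i = j := by
  rcases lt_trichotomy i j with h1 | h1 | h1
  · have := bd_lt ν h1 hj; omega
  · exact h1
  · have := bd_lt ν h1 hi; omega

lemma bd_injOn (N : ℕ) (ν : YoungDiagram) : Set.InjOn (bd N ν) (range N : Set ℕ) := by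
  intro i hi j hj h
  exact bd_inj ν (by simpa using hi) (by simpa using hj) h

lemma card_beads (N : ℕ) (ν : YoungDiagram) : (beads N ν).card = N := by
  rw [beads, card_image_of_injOn (bd_injOn N ν), card_range]

lemma cnt_beads (N : ℕ) (ν : YoungDiagram) (x : ℕ) :
    cnt (beads N ν) x = ((range N).filter (fun i => x ≤ bd N ν i)).card := by
  rw [cnt, beads, filter_image, card_image_of_injOn]
  exact (bd_injOn N ν).mono (by intro a; simp; tauto)

lemma le_bd_iff {N : ℕ} (ν : YoungDiagram) {i : ℕ} (hi : i < N) (x : ℕ) :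
    x ≤ bd N ν i ↔ i < cnt (beads N ν) x := by
  rw [cnt_beads]
  constructor
  · intro h
    have : range (i + 1) ⊆ (range N).filter (fun i => x ≤ bd N ν i) := by
      intro j hj
      simp only [mem_range, mem_filter] at hj ⊢
      refine ⟨by omega, ?_⟩
      rcases Nat.lt_or_ge j i with h1 | h1
      · have := bd_lt ν h1 hi; omega
      · have : j = i := by omega
        rw [this]; exact h
    have := card_le_card this
    rw [card_range] at this
    omega
  · intro h
    by_contra hx
    have : (range N).filter (fun i => x ≤ bd N ν i) ⊆ range i := by
      intro j hj
      simp only [mem_range, mem_filter] at hj ⊢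
      by_contra h1
      rcases Nat.lt_or_ge i j with h2 | h2
      · have := bd_lt ν h2 hj.1; omega
      · have : j = i := by omega
        rw [this] at hj; exact hx hj.2
    have := card_le_card this
    rw [card_range] at this
    omega

lemma cnt_succ (S : Finset ℕ) (x : ℕ) :
    cnt S x = cnt S (x + 1) + if x ∈ S then 1 else 0 := by
  have : S.filter (fun s => x ≤ s) = S.filter (fun s => x + 1 ≤ s) ∪ S.filter (fun s => s = x) := by
    ext y
    simp only [mem_filter, mem_union]
    constructor
    · rintro ⟨h1, h2⟩
      by_cases h : y = x
      · exact Or.inr ⟨h1, h⟩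
      · exact Or.inl ⟨h1, by omega⟩
    · rintro (⟨h1, h2⟩ | ⟨h1, h2⟩)
      · exact ⟨h1, by omega⟩
      · exact ⟨h1, by omega⟩
  rw [cnt, this, card_union_of_disjoint]
  · rw [cnt, filter_eq']
    split_ifs <;> simp
  · rw [Finset.disjoint_left]
    intro y
    simp only [mem_filter]
    omega

lemma set_of_cnt {S T : Finset ℕ} {a k : ℕ} (hk : 1 ≤ k)
    (h : ∀ x, cnt T x = cnt S x + if a < x ∧ x ≤ a + k then 1 else 0) :
    a ∈ S ∧ a + k ∉ S ∧ T = insert (a + k) (S.erase a) := by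
  have key : ∀ x, (if x ∈ T then 1 else 0) + (if x = a then 1 else 0) =
      (if x ∈ S then 1 else 0) + (if x = a + k then 1 else 0) := by
    intro x
    have h1 := cnt_succ S x
    have h2 := cnt_succ T x
    have h3 := h x
    have h4 := h (x + 1)
    split_ifs at * <;> omega
  refine ⟨?_, ?_, ?_⟩
  · have := key a
    by_contra hc
    simp [hc] at this
    split_ifs at this <;> omega
  · have := key (a + k)
    intro hc
    simp [hc] at this
    split_ifs at this <;> omega
  · ext x
    have := key x
    simp only [mem_insert, mem_erase]
    split_ifs at this <;> first | omega | simp_all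

lemma cnt_of_set {S : Finset ℕ} {a k : ℕ} (ha : a ∈ S) (hak : a + k ∉ S) (x : ℕ) :
    cnt (insert (a + k) (S.erase a)) x = cnt S x + if a < x ∧ x ≤ a + k then 1 else 0 := by
  have h1 : cnt (insert (a + k) (S.erase a)) x
      = cnt (S.erase a) x + if x ≤ a + k then 1 else 0 := by
    unfold cnt
    rw [card_filter, card_filter, sum_insert (by simp [hak])]
    omega
  have h2 : cnt S x = cnt (S.erase a) x + if x ≤ a then 1 else 0 := by
    unfold cnt
    rw [card_filter, card_filter, ← add_sum_erase S _ ha]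
    omega
  rw [h1, h2]
  split_ifs <;> omega

lemma cnt_zero (S : Finset ℕ) : cnt S 0 = S.card := by simp [cnt]

lemma mem_iff_bd {N : ℕ} {μ : YoungDiagram} (hμ : RN N μ) (c : ℕ × ℕ) :
    c ∈ μ.cells ↔ c.1 < N ∧ c.2 + (N - 1 - c.1) < bd N μ c.1 := by
  obtain ⟨i, j⟩ := c
  rw [YoungDiagram.mem_cells, YoungDiagram.mem_iff_lt_rowLen]
  have := hμ i
  simp only [bd]
  constructor
  · intro h
    refine ⟨?_, by omega⟩
    by_contra hc
    have := this (by omega)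
    omega
  · rintro ⟨h1, h2⟩
    omega

lemma RN_of_le {N : ℕ} {μ ν : YoungDiagram} (h : μ ≤ ν) (hν : RN N ν) : RN N μ := by
  intro i hi
  by_contra hc
  have h1 : (i, 0) ∈ μ := by rw [YoungDiagram.mem_iff_lt_rowLen]; omega
  have h2 : (i, 0) ∈ ν := h h1
  rw [YoungDiagram.mem_iff_lt_rowLen, hν i hi] at h2
  omega

lemma mem_sdiff_iff {N : ℕ} {μ ν : YoungDiagram} (hμ : RN N μ) (hν : RN N ν) (c : ℕ × ℕ) :
    c ∈ ν.cells \ μ.cells ↔ c.1 < N ∧ bd N μ c.1 ≤ c.2 + (N - 1 - c.1) ∧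
      c.2 + (N - 1 - c.1) < bd N ν c.1 := by
  rw [mem_sdiff, mem_iff_bd hμ, mem_iff_bd hν]
  constructor
  · rintro ⟨⟨h1, h2⟩, h3⟩
    refine ⟨h1, ?_, h2⟩
    by_contra hc
    exact h3 ⟨h1, by omega⟩
  · rintro ⟨h1, h2, h3⟩
    exact ⟨⟨h1, h3⟩, fun h => by omega⟩

lemma bd_mono {N : ℕ} {μ ν : YoungDiagram} (h : μ ≤ ν) (i : ℕ) : bd N μ i ≤ bd N ν i := by
  unfold bd
  have : μ.rowLen i ≤ ν.rowLen i := by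
    by_contra hc
    have h1 : (i, ν.rowLen i) ∈ μ := by rw [YoungDiagram.mem_iff_lt_rowLen]; omega
    have h2 : (i, ν.rowLen i) ∈ ν := h h1
    rw [YoungDiagram.mem_iff_lt_rowLen] at h2
    omega
  omega

/-- Shifted content. -/
def sc (N : ℕ) (c : ℕ × ℕ) : ℕ := c.2 + (N - 1 - c.1)

lemma card_fiber {N : ℕ} {μ ν : YoungDiagram} (h : μ ≤ ν) (hν : RN N ν) (x : ℕ) :
    cnt (beads N ν) (x + 1) = cnt (beads N μ) (x + 1) +
      ((ν.cells \ μ.cells).filter (fun c => sc N c = x)).card := by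
  have hμ := RN_of_le h hν
  have e1 : ((ν.cells \ μ.cells).filter (fun c => sc N c = x)).card =
      ((range N).filter (fun i => bd N μ i ≤ x ∧ x < bd N ν i)).card := by
    apply card_bij (fun c _ => c.1)
    · intro c hc
      rw [mem_filter, mem_sdiff_iff hμ hν] at hc
      unfold sc at hc
      rw [mem_filter, mem_range]
      refine ⟨hc.1.1, ?_, ?_⟩ <;> omega
    · intro c hc d hd hcd
      rw [mem_filter, mem_sdiff_iff hμ hν] at hc hd
      unfold sc at hc hd
      have h1 := hc.2
      have h2 := hd.2
      rw [hcd] at h1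
      ext
      · exact hcd
      · omega
    · intro i hi
      rw [mem_filter, mem_range] at hi
      have : N - 1 - i ≤ bd N μ i := by unfold bd; omega
      refine ⟨(i, x - (N - 1 - i)), ?_, rfl⟩
      rw [mem_filter, mem_sdiff_iff hμ hν]
      unfold sc
      have e : x - (N - 1 - i) + (N - 1 - i) = x := by omega
      simp only [e]
      exact ⟨hi, trivial⟩
  rw [e1, cnt_beads, cnt_beads, ← card_union_of_disjoint]
  · congr 1
    ext i
    simp only [mem_filter, mem_union, mem_range]
    have := bd_mono (N := N) h i
    constructor
    · rintro ⟨h1, h2⟩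
      by_cases h3 : x + 1 ≤ bd N μ i
      · exact Or.inl ⟨h1, h3⟩
      · exact Or.inr ⟨h1, by omega, by omega⟩
    · rintro (⟨h1, h2⟩ | ⟨h1, h2, h3⟩)
      · exact ⟨h1, by omega⟩
      · exact ⟨h1, by omega⟩
  · rw [Finset.disjoint_left]
    intro y
    simp only [mem_filter]
    omega

lemma isSkewHook_iff (s : Finset (ℕ × ℕ)) : IsSkewHook s ↔
    s.Nonempty ∧ (contentsOf s).card = s.card ∧
    ∃ a : ℤ, contentsOf s = (Finset.range s.card).image (fun t : ℕ => a + (t : ℤ)) := by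
  unfold IsSkewHook
  apply and_congr_right
  intro _
  apply and_congr_right
  intro _
  apply exists_congr
  intro a
  apply Eq.congr_right
  ext z
  simp only [bind_def, pure_def, mem_image, mem_sup, mem_singleton, mem_range]
  constructor
  · rintro ⟨t, ⟨n, hn, rfl⟩, rfl⟩
    exact ⟨n, hn, rfl⟩
  · rintro ⟨n, hn, rfl⟩
    exact ⟨n, ⟨n, hn, rfl⟩, rfl⟩

lemma hook_iff_fiber {N k : ℕ} {T : Finset (ℕ × ℕ)} (hT : ∀ c ∈ T, c.1 < N) :
    (T.card = k ∧ IsSkewHook T) ↔ 1 ≤ k ∧ ∃ a : ℕ, ∀ x,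
      (T.filter (fun c => sc N c = x)).card = if a ≤ x ∧ x < a + k then 1 else 0 := by
  rw [isSkewHook_iff]
  have hsc : ∀ c ∈ T, ((c.2 : ℤ) - (c.1 : ℤ)) = (sc N c : ℤ) - (N - 1 : ℤ) := by
    intro c hc
    have := hT c hc
    unfold sc
    omega
  constructor
  · rintro ⟨hk, hne, hcard, a, ha⟩
    have hpos : 1 ≤ k := by rw [← hk]; exact card_pos.2 hne
    rw [hk] at ha
    have hinj : Set.InjOn (fun p : ℕ × ℕ => (p.2 : ℤ) - (p.1 : ℤ)) T := card_image_iff.1 hcard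
    have ha0 : a ∈ contentsOf T := by
      rw [ha, mem_image]
      exact ⟨0, by rw [mem_range]; omega, by simp⟩
    obtain ⟨c0, hc0, hc0a⟩ := mem_image.1 ha0
    simp only [hsc c0 hc0] at hc0a
    refine ⟨hpos, sc N c0, fun x => ?_⟩
    split_ifs with hx
    · have : (x : ℤ) - (N - 1) ∈ contentsOf T := by
        rw [ha, mem_image]
        refine ⟨x - sc N c0, by rw [mem_range]; omega, by omega⟩
      obtain ⟨c, hc, hca⟩ := mem_image.1 this
      simp only [hsc c hc] at hca
      rw [card_eq_one]
      refine ⟨c, ?_⟩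
      ext d
      rw [mem_filter, mem_singleton]
      constructor
      · rintro ⟨hd, hdx⟩
        apply hinj hd hc
        simp only [hsc c hc, hsc d hd]
        omega
      · rintro rfl
        exact ⟨hc, by omega⟩
    · rw [card_eq_zero, filter_eq_empty_iff]
      intro c hc hcx
      have : (c.2 : ℤ) - (c.1 : ℤ) ∈ contentsOf T := mem_image.2 ⟨c, hc, rfl⟩
      rw [ha, mem_image] at this
      obtain ⟨t, ht, hta⟩ := this
      rw [hsc c hc] at hta
      rw [mem_range] at ht
      omega
  · rintro ⟨hk, a, ha⟩
    have hinj : Set.InjOn (sc N) T := by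
      intro c hc d hd hcd
      have h1 := ha (sc N c)
      have h2 : (T.filter (fun e => sc N e = sc N c)).card ≤ 1 := by
        rw [h1]; split_ifs <;> omega
      rw [card_le_one] at h2
      apply h2
      · rw [mem_filter]; exact ⟨hc, rfl⟩
      · rw [mem_filter]; exact ⟨hd, hcd.symm⟩
    have himg : T.image (sc N) = Ico a (a + k) := by
      ext x
      rw [mem_Ico, mem_image]
      have h1 := ha x
      constructor
      · rintro ⟨c, hc, hcx⟩
        by_contra hx
        rw [if_neg hx, card_eq_zero, filter_eq_empty_iff] at h1
        exact h1 hc hcx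
      · intro hx
        rw [if_pos hx, card_eq_one] at h1
        obtain ⟨c, hc⟩ := h1
        have : c ∈ T.filter (fun c => sc N c = x) := by rw [hc]; simp
        rw [mem_filter] at this
        exact ⟨c, this⟩
    have hcard : T.card = k := by
      rw [← card_image_of_injOn hinj, himg]; simp
    refine ⟨hcard, ?_, ?_, (a : ℤ) - (N - 1), ?_⟩
    · rw [← card_pos]; omega
    · apply card_image_of_injOn
      intro c hc d hd hcd
      simp only [hsc c hc, hsc d hd] at hcd
      exact hinj hc hd (by omega)
    · rw [hcard]
      ext z
      rw [contentsOf, mem_image, mem_image]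
      constructor
      · rintro ⟨c, hc, rfl⟩
        have : sc N c ∈ Ico a (a + k) := by rw [← himg]; exact mem_image_of_mem _ hc
        rw [mem_Ico] at this
        rw [hsc c hc]
        exact ⟨sc N c - a, by rw [mem_range]; omega, by omega⟩
      · rintro ⟨t, ht, rfl⟩
        rw [mem_range] at ht
        have : a + t ∈ T.image (sc N) := by rw [himg, mem_Ico]; omega
        obtain ⟨c, hc, hct⟩ := mem_image.1 this
        refine ⟨c, hc, ?_⟩
        simp only [hsc c hc]
        omega

lemma le_of_cnt {N : ℕ} {μ ν : YoungDiagram} (hμ : RN N μ)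
    (h : ∀ x, cnt (beads N μ) x ≤ cnt (beads N ν) x) : μ ≤ ν := by
  rintro ⟨i, j⟩ hc
  have h1 := (mem_iff_bd hμ (i, j)).1 hc
  simp only at h1
  have h2 := (le_bd_iff μ h1.1 (j + (N - 1 - i) + 1)).1 h1.2
  have h3 := (le_bd_iff ν h1.1 (j + (N - 1 - i) + 1)).2 (lt_of_lt_of_le h2 (h _))
  change (i, j) ∈ ν
  rw [YoungDiagram.mem_iff_lt_rowLen]
  unfold bd at h3
  omega

lemma beads_inj {N : ℕ} {μ ν : YoungDiagram} (hμ : RN N μ) (hν : RN N ν)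
    (h : beads N μ = beads N ν) : μ = ν :=
  le_antisymm (le_of_cnt hμ (fun x => by rw [h])) (le_of_cnt hν (fun x => by rw [h]))

lemma hookStep_iff {N k : ℕ} {μ ν : YoungDiagram} (hμ : RN N μ) (hν : RN N ν) :
    hookStep k μ ν ↔ 1 ≤ k ∧ ∃ a : ℕ, ∀ x, cnt (beads N ν) x =
      cnt (beads N μ) x + if a < x ∧ x ≤ a + k then 1 else 0 := by
  have hT : ∀ c ∈ ν.cells \ μ.cells, c.1 < N := fun c hc => ((mem_sdiff_iff hμ hν c).1 hc).1
  constructor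
  · rintro ⟨hle, h⟩
    obtain ⟨hk, a, ha⟩ := (hook_iff_fiber hT).1 h
    refine ⟨hk, a, fun x => ?_⟩
    cases x with
    | zero => rw [cnt_zero, cnt_zero, card_beads, card_beads]; simp
    | succ x =>
      rw [card_fiber hle hν, ha x]
      congr 1
      apply if_congr _ rfl rfl
      omega
  · rintro ⟨hk, a, ha⟩
    have hle : μ ≤ ν := le_of_cnt hμ (fun x => by rw [ha x]; omega)
    refine ⟨hle, (hook_iff_fiber hT).2 ⟨hk, a, fun x => ?_⟩⟩
    have h1 := card_fiber hle hν x
    have h2 := ha (x + 1)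
    split_ifs at * <;> omega

lemma skewL_eq {N k a : ℕ} {μ ν : YoungDiagram} (hμ : RN N μ) (hν : RN N ν) (hk : 1 ≤ k)
    (ha : ∀ x, cnt (beads N ν) x =
      cnt (beads N μ) x + if a < x ∧ x ≤ a + k then 1 else 0) :
    skewL (ν.cells \ μ.cells) =
      ((beads N μ).filter (fun s => a < s ∧ s < a + k)).card := by
  have hS := (set_of_cnt hk ha).1
  have h1 : (ν.cells \ μ.cells).image Prod.fst =
      (range N).filter (fun i => a ≤ bd N μ i ∧ bd N μ i < a + k) := by
    ext i
    rw [mem_image, mem_filter, mem_range]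
    constructor
    · rintro ⟨c, hc, rfl⟩
      rw [mem_sdiff_iff hμ hν] at hc
      refine ⟨hc.1, ?_⟩
      have e1 := (le_bd_iff ν hc.1 (bd N μ c.1 + 1)).1 (by omega)
      have e2 := (not_congr (le_bd_iff μ hc.1 (bd N μ c.1 + 1))).1 (by omega)
      have e3 := ha (bd N μ c.1 + 1)
      split_ifs at e3 <;> omega
    · rintro ⟨hi, hb⟩
      have e3 := ha (bd N μ i + 1)
      rw [if_pos (by omega)] at e3
      have e4 : i ≤ cnt (beads N μ) (bd N μ i + 1) := by
        rcases Nat.eq_zero_or_pos i with h0 | h0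
        · omega
        · have := bd_lt μ (show i - 1 < i by omega) hi
          have := (le_bd_iff μ (show i - 1 < N by omega) (bd N μ i + 1)).1 (by omega)
          omega
      have e5 := (le_bd_iff ν hi (bd N μ i + 1)).2 (by omega)
      refine ⟨(i, μ.rowLen i), ?_, rfl⟩
      rw [mem_sdiff_iff hμ hν]
      exact ⟨hi, le_refl _, e5⟩
  have h2 : ((range N).filter (fun i => a ≤ bd N μ i ∧ bd N μ i < a + k)).card =
      ((beads N μ).filter (fun s => a ≤ s ∧ s < a + k)).card := by
    rw [beads, filter_image, card_image_of_injOn]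
    exact (bd_injOn N μ).mono (by intro a; simp; tauto)
  have h3 : (beads N μ).filter (fun s => a ≤ s ∧ s < a + k) =
      insert a ((beads N μ).filter (fun s => a < s ∧ s < a + k)) := by
    ext s
    simp only [mem_filter, mem_insert]
    constructor
    · rintro ⟨h1, h2, h3⟩
      by_cases h : s = a
      · exact Or.inl h
      · exact Or.inr ⟨h1, by omega, h3⟩
    · rintro (rfl | ⟨h1, h2, h3⟩)
      · exact ⟨hS, le_refl _, by omega⟩
      · exact ⟨h1, h2.le, h3⟩
  rw [skewL, h1, h2, h3, card_insert_of_notMem (by simp)]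
  omega

lemma exists_beads {N : ℕ} (S : Finset ℕ) (hS : S.card = N) :
    ∃ ν, RN N ν ∧ beads N ν = S := by
  let e := S.orderEmbOfFin hS
  have hge : ∀ (n : ℕ) (i j : Fin N), (j : ℕ) = i + n → e i + n ≤ e j := by
    intro n
    induction n with
    | zero =>
      intro i j h
      have : i = j := Fin.ext (by omega)
      rw [this]; simp
    | succ n ih =>
      intro i j h
      have h1 := ih i ⟨i + n, by omega⟩ rfl
      have h2 : e ⟨i + n, by omega⟩ < e j := e.strictMono (by rw [Fin.lt_def]; change (i : ℕ) + n < j; omega)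
      omega
  have hge0 : ∀ j : Fin N, (j : ℕ) ≤ e j := by
    intro j
    have := hge j ⟨0, j.pos⟩ j (by simp)
    omega
  let w : List ℕ := List.ofFn (fun i : Fin N => e i.rev - (N - 1 - i))
  have hw : w.SortedGE := by
    apply List.Pairwise.sortedGE
    rw [List.pairwise_ofFn]
    intro i j hij
    have := hge (j - i) j.rev i.rev (by rw [Fin.lt_def] at hij; rw [Fin.val_rev, Fin.val_rev]; omega)
    have := hge0 j.rev
    have := hge0 i.rev
    simp only [Fin.val_rev] at *
    rw [Fin.lt_def] at hij
    omega
  have hrow : ∀ i (hi : i < N),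
      (YoungDiagram.ofRowLens w hw).rowLen i = e (Fin.rev ⟨i, hi⟩) - (N - 1 - i) := by
    intro i hi
    have := YoungDiagram.rowLen_ofRowLens (hw := hw) ⟨i, by simpa [w] using hi⟩
    rw [this]
    simp [w]
  have hbd : ∀ i (hi : i < N), bd N (YoungDiagram.ofRowLens w hw) i = e (Fin.rev ⟨i, hi⟩) := by
    intro i hi
    rw [bd, hrow i hi]
    have := hge0 (Fin.rev ⟨i, hi⟩)
    simp only [Fin.val_rev] at this
    omega
  refine ⟨YoungDiagram.ofRowLens w hw, ?_, ?_⟩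
  · intro i hi
    by_contra hc
    have h1 : (i, 0) ∈ YoungDiagram.ofRowLens w hw := by
      rw [YoungDiagram.mem_iff_lt_rowLen]; omega
    rw [YoungDiagram.mem_ofRowLens] at h1
    obtain ⟨h2, _⟩ := h1
    simp [w] at h2
    omega
  · apply eq_of_subset_of_card_le
    · intro x hx
      rw [beads, mem_image] at hx
      obtain ⟨i, hi, rfl⟩ := hx
      rw [hbd i (by simpa using hi)]
      exact S.orderEmbOfFin_mem hS _
    · rw [card_beads, hS]

/-- The adjoint Murnaghan–Nakayama sum, expressed through bead sets. -/
lemma hook_sum {N : ℕ} (Y : Finset ℕ → YoungDiagram)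
    (hY : ∀ S : Finset ℕ, S.card = N → RN N (Y S) ∧ beads N (Y S) = S)
    (w : YoungDiagram → ℂ) (hw : ∀ ν, ¬ RN N ν → w ν = 0) (μ : YoungDiagram) (hμ : RN N μ)
    (k : ℕ) (hk : 1 ≤ k) :
    (∑ᶠ ν, if hookStep k μ ν then (-1 : ℂ) ^ skewL (ν.cells \ μ.cells) * w ν else 0) =
    ∑ a ∈ (beads N μ).filter (fun a => a + k ∉ beads N μ),
        (-1 : ℂ) ^ ((beads N μ).filter (fun s => a < s ∧ s < a + k)).card *
          w (Y (insert (a + k) ((beads N μ).erase a))) := by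
  set S := beads N μ with hS
  set A := S.filter (fun a => a + k ∉ S) with hA
  set g : ℕ → YoungDiagram := fun a => Y (insert (a + k) (S.erase a)) with hg
  have hYb : ∀ ν, RN N ν → Y (beads N ν) = ν := by
    intro ν hν
    have := hY (beads N ν) (card_beads N ν)
    exact beads_inj this.1 hν this.2
  have hcard : ∀ a ∈ A, (insert (a + k) (S.erase a)).card = N := by
    intro a ha
    rw [hA, mem_filter] at ha
    rw [card_insert_of_notMem (by simp [ha.2]), card_erase_of_mem ha.1, hS, card_beads]
    have : 0 < S.card := card_pos.2 ⟨a, ha.1⟩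
    rw [hS, card_beads] at this
    omega
  have hginj : Set.InjOn g A := by
    intro a ha b hb hab
    have h1 := (hY _ (hcard a ha)).2
    have h2 := (hY _ (hcard b hb)).2
    have h3 : insert (a + k) (S.erase a) = insert (b + k) (S.erase b) := by
      rw [← h1, ← h2]
      exact congrArg _ hab
    by_contra hne
    have ha' : a ∈ S := (mem_filter.1 ha).1
    have h4 : a ∈ insert (b + k) (S.erase b) := by simp [ha', hne]
    rw [← h3] at h4
    simp at h4
    omega
  rw [finsum_eq_sum_of_support_subset (s := A.image g), sum_image hginj]
  · apply sum_congr rfl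
    intro a ha
    have hYa := hY _ (hcard a ha)
    have ha' := mem_filter.1 ha
    have hc : ∀ x, cnt (beads N (g a)) x =
        cnt (beads N μ) x + if a < x ∧ x ≤ a + k then 1 else 0 := by
      intro x
      rw [hYa.2]
      exact cnt_of_set ha'.1 ha'.2 x
    rw [if_pos ((hookStep_iff hμ hYa.1).2 ⟨hk, a, hc⟩), skewL_eq hμ hYa.1 hk hc]
  · intro ν hν
    rw [Function.mem_support] at hν
    have hstep : hookStep k μ ν := by
      by_contra hc
      rw [if_neg hc] at hν
      exact hν rfl
    have hR : RN N ν := by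
      by_contra hc
      rw [hw ν hc] at hν
      simp at hν
    obtain ⟨_, a, ha⟩ := (hookStep_iff hμ hR).1 hstep
    obtain ⟨h1, h2, h3⟩ := set_of_cnt hk ha
    rw [mem_coe, mem_image]
    refine ⟨a, mem_filter.2 ⟨h1, h2⟩, ?_⟩
    rw [hg]
    simp only
    rw [hS, ← h3, hYb ν hR]

/-- Core statement: a function killed by all the (adjoint) Heisenberg lowering operators is
supported at the empty diagram. -/
lemma core (N : ℕ) (w : YoungDiagram → ℂ) (hw : ∀ ν, ¬ RN N ν → w ν = 0)
    (h : ∀ k, 1 ≤ k → ∀ μ : YoungDiagram,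
      (∑ᶠ ν, if hookStep k μ ν then (-1 : ℂ) ^ skewL (ν.cells \ μ.cells) * w ν else 0) = 0)
    (ν : YoungDiagram) (hν : ν ≠ ⊥) : w ν = 0 := by
  by_cases hR : RN N ν
  swap
  · exact hw ν hR
  have hex : ∀ S : Finset ℕ, ∃ ν, S.card = N → RN N ν ∧ beads N ν = S := by
    intro S
    by_cases hS : S.card = N
    · obtain ⟨ν, h⟩ := exists_beads S hS
      exact ⟨ν, fun _ => h⟩
    · exact ⟨⊥, fun h => absurd h hS⟩
  choose Y hY using hex
  let W : (Fin N → ℕ) → ℂ := Wf (fun S => w (Y S))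
  have hW : ∀ k, 1 ≤ k → ∀ α : Fin N → ℕ, ∑ i, W (α + Pi.single i k) = 0 := by
    intro k hk α
    by_cases hα : Function.Injective α
    · have hc : (univ.image α).card = N := by
        rw [card_image_of_injective _ hα]; simp
      have h1 := hY _ hc
      have h2 := hook_sum Y hY w hw _ h1.1 k hk
      rw [h k hk, h1.2] at h2
      rw [sum_Wf_inj _ α hα k hk, ← h2, mul_zero]
    · exact sum_Wf_not_inj _ α hα k
  have hrow : 0 < ν.rowLen 0 := by
    by_contra hc
    apply hν
    ext ⟨i, j⟩
    simp only [YoungDiagram.cells_bot, notMem_empty, iff_false]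
    intro hm
    have : (0, 0) ∈ ν := ν.up_left_mem (Nat.zero_le i) (Nat.zero_le j) hm
    rw [YoungDiagram.mem_iff_lt_rowLen] at this
    omega
  have hN : 0 < N := by
    by_contra hc
    have := hR 0 (by omega)
    omega
  let α : Fin N → ℕ := fun i => bd N ν i
  have hα : Function.Injective α := fun i j hij => Fin.ext (bd_inj ν i.2 j.2 hij)
  have himg : univ.image α = beads N ν := by
    ext x
    simp only [beads, mem_image, mem_univ, true_and, mem_range, α]
    constructor
    · rintro ⟨i, rfl⟩; exact ⟨i, i.2, rfl⟩
    · rintro ⟨i, hi, rfl⟩; exact ⟨⟨i, hi⟩, rfl⟩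
  have h0 : W α = 0 := by
    apply vanish_of_psum N W hW α ⟨0, hN⟩
    simp only [α, bd]
    omega
  have hYν : Y (beads N ν) = ν := by
    have := hY (beads N ν) (card_beads N ν)
    exact beads_inj this.1 hR this.2
  have hsg : (sg α : ℂ) ≠ 0 := by
    have := sg_mul_self hα
    intro hc
    have : sg α = 0 := by exact_mod_cast hc
    simp_all
  simp only [W, Wf, himg, hYν] at h0
  exact (mul_eq_zero.1 h0).resolve_left hsg

end FockAux

/-! ### The operators -/

namespace FockAux

open Finset

lemma finite_card_le (n : ℕ) : {ν : YoungDiagram | ν.card ≤ n}.Finite := by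
  have h1 : ({s : Finset (ℕ × ℕ) | s ⊆ range n ×ˢ range n}).Finite := by
    apply (((range n ×ˢ range n).powerset : Finset _).finite_toSet).subset
    intro s hs
    exact mem_coe.2 (mem_powerset.2 hs)
  apply Set.Finite.of_injOn (f := YoungDiagram.cells) (t := {s | s ⊆ range n ×ˢ range n}) _ _ h1
  · rintro ν hν ⟨i, j⟩ hc
    have hν' : ν.cells.card ≤ n := hν
    rw [mem_product, mem_range, mem_range]
    constructor
    · have : (range (i + 1)).image (fun a => (a, j)) ⊆ ν.cells := by
        intro c hc'
        rw [mem_image] at hc'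
        obtain ⟨a, ha, rfl⟩ := hc'
        rw [mem_range] at ha
        exact ν.up_left_mem (by omega) (le_refl j) hc
      have := card_le_card this
      rw [card_image_of_injective _ (fun a b h => by simpa using h), card_range] at this
      simp only
      omega
    · have : (range (j + 1)).image (fun a => (i, a)) ⊆ ν.cells := by
        intro c hc'
        rw [mem_image] at hc'
        obtain ⟨a, ha, rfl⟩ := hc'
        rw [mem_range] at ha
        exact ν.up_left_mem (le_refl i) (by omega) hc
      have := card_le_card this
      rw [card_image_of_injective _ (fun a b h => by simpa using h), card_range] at this
      simp only
      omega
  · intro a _ b _ h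
    exact YoungDiagram.ext h

lemma hookStep_card {k : ℕ} {μ ν : YoungDiagram} (h : hookStep k μ ν) :
    ν.card = μ.card + k := by
  obtain ⟨h1, h2, _⟩ := h
  have := card_sdiff_add_card_eq_card (YoungDiagram.cells_subset_iff.2 h1)
  change ν.cells.card = μ.cells.card + k
  omega

lemma LamTarget_pos_apply (k : ℕ) (hk : 1 ≤ k) (lam μ : YoungDiagram) :
    LamTarget k lam μ = if hookStep k μ lam then (-1 : ℂ) ^ skewL (lam.cells \ μ.cells) else 0 := by
  rw [LamTarget, if_pos (by omega)]
  simp only [Int.toNat_natCast]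
  have hfin : (Function.support fun μ : YoungDiagram => if hookStep k μ lam then
      ((-1 : ℂ) ^ skewL (lam.cells \ μ.cells)) • Finsupp.single μ (1 : ℂ) else 0).Finite := by
    apply (finite_card_le lam.card).subset
    intro μ hμ
    rw [Function.mem_support] at hμ
    have : hookStep k μ lam := by
      by_contra hc
      exact hμ (if_neg hc)
    have := hookStep_card this
    change μ.card ≤ lam.card
    omega
  have h2 := (Finsupp.applyAddHom μ : (YoungDiagram →₀ ℂ) →+ ℂ).map_finsum hfin
  rw [Finsupp.applyAddHom_apply] at h2
  rw [h2, finsum_eq_single _ μ]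
  · split_ifs <;> simp
  · intro x hx
    split_ifs <;> simp [hx]

lemma Lam_pos_apply (k : ℕ) (hk : 1 ≤ k) (v : FermionicFock) (μ : YoungDiagram) :
    Lam k v μ =
      ∑ᶠ ν, if hookStep k μ ν then (-1 : ℂ) ^ skewL (ν.cells \ μ.cells) * v ν else 0 := by
  have h1 : Lam k v = v.sum (fun lam c => c • LamTarget k lam) := by
    simp [Lam]
  rw [h1, Finsupp.sum, Finsupp.finsetSum_apply,
    finsum_eq_sum_of_support_subset (s := v.support)]
  · apply sum_congr rfl
    intro ν _
    rw [Finsupp.smul_apply, LamTarget_pos_apply k hk]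
    split_ifs
    · rw [smul_eq_mul, mul_comm]
    · simp
  · intro ν hν
    rw [Function.mem_support] at hν
    rw [mem_coe, Finsupp.mem_support_iff]
    intro hc
    apply hν
    simp [hc]

lemma map_Lam_neg (k : ℕ) (hk : 1 ≤ k) (f : FermionicFock →ₗ[ℂ] ℂ) (μ : YoungDiagram) :
    f (Lam (-(k : ℤ)) (Finsupp.single μ 1)) =
      ∑ᶠ ν, if hookStep k μ ν then (-1 : ℂ) ^ skewL (ν.cells \ μ.cells) *
        f (Finsupp.single ν 1) else 0 := by
  have h1 : Lam (-(k : ℤ)) (Finsupp.single μ 1) = LamTarget (-(k : ℤ)) μ := by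
    simp [Lam]
  rw [h1, LamTarget, if_neg (by omega), if_pos (by omega)]
  simp only [neg_neg, Int.toNat_natCast]
  have hfin : (Function.support fun ν : YoungDiagram => if hookStep k μ ν then
      ((-1 : ℂ) ^ skewL (ν.cells \ μ.cells)) • Finsupp.single ν (1 : ℂ) else 0).Finite := by
    apply (finite_card_le (μ.card + k)).subset
    intro ν hν
    rw [Function.mem_support] at hν
    have : hookStep k μ ν := by
      by_contra hc
      exact hν (if_neg hc)
    exact (hookStep_card this).le
  have h2 := f.toAddMonoidHom.map_finsum hfin
  refine h2.trans ?_
  apply finsum_congr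
  intro ν
  split_ifs
  · exact f.map_smul _ _
  · exact f.map_zero

lemma RN_card (ν : YoungDiagram) : RN ν.card ν := by
  intro i hi
  by_contra hc
  have h1 : (i, 0) ∈ ν := by rw [YoungDiagram.mem_iff_lt_rowLen]; omega
  have : (range (i + 1)).image (fun a => (a, 0)) ⊆ ν.cells := by
    intro c hc'
    rw [mem_image] at hc'
    obtain ⟨a, ha, rfl⟩ := hc'
    rw [mem_range] at ha
    exact ν.up_left_mem (by omega) (le_refl 0) h1
  have := card_le_card this
  rw [card_image_of_injective _ (fun a b h => by simpa using h), card_range] at this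
  change ν.cells.card ≤ i at hi
  omega

lemma RN_mono {N M : ℕ} (h : N ≤ M) {ν : YoungDiagram} (hν : RN N ν) : RN M ν :=
  fun i hi => hν i (h.trans hi)

lemma vacuum_mem (p : Submodule ℂ FermionicFock)
    (hp : ∀ (k : ℤ), k ≠ 0 → ∀ v ∈ p, Lam k v ∈ p) (d : ℕ) :
    ∀ v ∈ p, v ≠ 0 → (∀ ν, v ν ≠ 0 → ν.card ≤ d) → Finsupp.single ⊥ (1 : ℂ) ∈ p := by
  induction d using Nat.strong_induction_on with
  | _ d ih =>
    intro v hv hv0 hd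
    by_cases hall : ∀ k : ℕ, 1 ≤ k → Lam k v = 0
    · have hz : ∀ ν, ν ≠ ⊥ → v ν = 0 := by
        apply core d v
        · intro ν hν
          by_contra hc
          exact hν (RN_mono (hd ν hc) (RN_card ν))
        · intro k hk μ
          rw [← Lam_pos_apply k hk, hall k hk]
          rfl
      have he : v = Finsupp.single ⊥ (v ⊥) := by
        ext ν
        by_cases h : ν = ⊥
        · subst h; simp
        · rw [hz ν h, Finsupp.single_apply, if_neg (Ne.symm h)]
      have hb : v ⊥ ≠ 0 := by
        intro hc
        rw [hc, Finsupp.single_zero] at he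
        exact hv0 he
      have : Finsupp.single ⊥ (1 : ℂ) = (v ⊥)⁻¹ • v := by
        rw [he]
        simp [hb]
      rw [this]
      exact p.smul_mem _ hv
    · push Not at hall
      obtain ⟨k, hk, hne⟩ := hall
      have hdeg : ∀ ν, Lam k v ν ≠ 0 → ν.card + k ≤ d := by
        intro μ hμ
        rw [Lam_pos_apply k hk] at hμ
        obtain ⟨ν, hν⟩ : ∃ ν, (if hookStep k μ ν then
            (-1 : ℂ) ^ skewL (ν.cells \ μ.cells) * v ν else 0) ≠ 0 := by
          by_contra hc
          push Not at hc
          exact hμ (finsum_eq_zero_of_forall_eq_zero hc)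
        have h1 : hookStep k μ ν := by
          by_contra hc
          exact hν (if_neg hc)
        rw [if_pos h1] at hν
        rw [← hookStep_card h1]
        exact hd ν (right_ne_zero_of_mul hν)
      obtain ⟨ν0, hν0⟩ := Finsupp.ne_iff.1 hne
      have := hdeg ν0 hν0
      refine ih (d - k) (by omega) (Lam k v) (hp k (by omega) v hv) hne ?_
      intro ν hν
      have := hdeg ν hν
      omega

lemma basis_mem (p : Submodule ℂ FermionicFock)
    (hp : ∀ (k : ℤ), k ≠ 0 → ∀ v ∈ p, Lam k v ∈ p) (h0 : Finsupp.single ⊥ (1 : ℂ) ∈ p) (n : ℕ) :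
    ∀ ν : YoungDiagram, ν.card = n → Finsupp.single ν (1 : ℂ) ∈ p := by
  induction n using Nat.strong_induction_on with
  | _ n ih =>
    intro lam hlam
    by_cases hb : lam = ⊥
    · rw [hb]; exact h0
    by_contra hmem
    obtain ⟨f, hf, hfp⟩ := Submodule.exists_le_ker_of_notMem hmem
    apply hf
    have := core n (fun ν => if ν.card = n then f (Finsupp.single ν 1) else 0) ?_ ?_ lam hb
    · simpa [hlam] using this
    · intro ν hν
      rw [if_neg]
      rintro rfl
      exact hν (RN_card ν)
    · intro k hk μ
      by_cases hμ : μ.card + k = n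
      · have h1 := map_Lam_neg k hk f μ
        have h2 : f (Lam (-(k : ℤ)) (Finsupp.single μ 1)) = 0 :=
          hfp (hp _ (by omega) _ (ih μ.card (by omega) μ rfl))
        rw [h2] at h1
        refine Eq.trans ?_ h1.symm
        apply finsum_congr
        intro ν
        split_ifs with h3 h4
        · rfl
        · exact absurd ((hookStep_card h3).trans hμ) h4
        · rfl
      · apply finsum_eq_zero_of_forall_eq_zero
        intro ν
        split_ifs with h3 h4
        · exact absurd ((hookStep_card h3).symm.trans h4) hμ
        · simp
        · rfl

end FockAux

/-- The fermionic Fock space is irreducible under the Heisenberg operators: any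
`ℂ`-subspace of `ℱ` invariant under all the operators `Λ_k` (`k` a nonzero integer) is
either `0` or all of `ℱ`. -/
theorem fermionic_fock_irreducible (p : Submodule ℂ FermionicFock)
    (hp : ∀ (k : ℤ), k ≠ 0 → ∀ v ∈ p, Lam k v ∈ p) :
    p = ⊥ ∨ p = ⊤ := by

  by_cases h : p = ⊥
  · exact Or.inl h
  right
  obtain ⟨v, hv, hv0⟩ := Submodule.exists_mem_ne_zero_of_ne_bot h
  have h0 : Finsupp.single ⊥ (1 : ℂ) ∈ p := by
    refine FockAux.vacuum_mem p hp (v.support.sup YoungDiagram.card) v hv hv0 ?_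
    intro ν hν
    exact Finset.le_sup (f := YoungDiagram.card) (Finsupp.mem_support_iff.2 hν)
  rw [eq_top_iff]
  intro x _
  induction x using Finsupp.induction_linear with
  | zero => exact p.zero_mem
  | add a b ha hb => exact p.add_mem (ha trivial) (hb trivial)
  | single ν c =>
    have : Finsupp.single ν c = c • Finsupp.single ν (1 : ℂ) := by simp
    rw [this]
    exact p.smul_mem _ (FockAux.basis_mem p hp h0 ν.card ν rfl)
end

section
/- (Boson–Fermion Correspondence, explicit form) For every partition λ and every integer n ≥ 1, the Schur polynomials satisfy: ∂S_λ/∂x_n = Σ_μ (−1)^{L(λ/μ)} S_μ, summed over partitions μ ⊆ λ with λ/μ a skew hook with n boxes, and n x_n S_λ = Σ_ν (−1)^{L(ν/λ)} S_ν, summed over partitions ν ⊇ λ with ν/λ a skew hook with n boxes. Equivalently, the linear isomorphism ℱ → ℂ[x_1, x_2, …] sending v_λ ↦ S_λ intertwines Λ_n with ∂/∂x_n and Λ_{−n} with multiplication by n x_n, for all n ≥ 1. -/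
open scoped Classical

/-- The elementary Schur polynomial `S_k` in `ℂ[x₁, x₂, …]` (the variable `xₙ` is
`MvPolynomial.X (n-1)`):  `S_k = Σ_{k₁+2k₂+⋯ = k} x₁^{k₁} x₂^{k₂} ⋯ /(k₁! k₂! ⋯)` for
`k ≥ 0` and `S_k = 0` for `k < 0`. -/
noncomputable def elemSchur (k : ℤ) : MvPolynomial ℕ ℂ :=
  if k < 0 then 0 else
    ∑ᶠ d : ℕ →₀ ℕ, if (d.sum fun i m => (i + 1) * m) = k.toNat then
      MvPolynomial.monomial d ((∏ i ∈ d.support, (Nat.factorial (d i) : ℂ))⁻¹) else 0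

/-- The Schur polynomial `S_λ = det (S_{λ_i + j − i})_{1 ≤ i,j ≤ N}` of a partition `λ`
(with `N` the number of nonzero rows of `λ` and `λ_i = rowLen (i-1)`). -/
noncomputable def schurPoly (lam : YoungDiagram) : MvPolynomial ℕ ℂ :=
  Matrix.det (Matrix.of fun i j : Fin (lam.colLen 0) =>
    elemSchur ((lam.rowLen i : ℤ) + (j : ℤ) - (i : ℤ)))

namespace BF

open MvPolynomial

/-- The weight of an exponent vector. -/
noncomputable def wt (d : ℕ →₀ ℕ) : ℕ := d.sum fun i m => (i + 1) * m

lemma wt_finite (k : ℕ) : {d : ℕ →₀ ℕ | wt d = k}.Finite := by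
  have hfin : (Set.range (fun g : Fin (k+1) → Fin (k+1) =>
      (Finsupp.onFinset (Finset.range (k+1))
        (fun i => if h : i < k+1 then (g ⟨i, h⟩ : ℕ) else 0)
        (by intro a ha; by_contra hc; simp at hc; apply ha; rw [dif_neg]; omega)
          : ℕ →₀ ℕ))).Finite := Set.finite_range _
  refine hfin.subset ?_
  intro d hd
  have key : ∀ i, (i + 1) * d i ≤ k := by
    intro i
    by_cases hi : i ∈ d.support
    · have := Finset.single_le_sum (f := fun i => (i + 1) * d i) (fun _ _ => Nat.zero_le _) hi
      have h2 : wt d = k := hd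
      rw [wt, Finsupp.sum] at h2
      omega
    · simp at hi; simp [hi]
  refine ⟨fun i => ⟨d i, ?_⟩, ?_⟩
  · have := key i; nlinarith
  · ext i
    simp only [Finsupp.onFinset_apply]
    split_ifs with h
    · rfl
    · have := key i
      by_contra hc
      have : 1 ≤ d i := Nat.one_le_iff_ne_zero.mpr (fun h => hc h.symm)
      nlinarith

lemma coeff_elemSchur (k : ℤ) (d : ℕ →₀ ℕ) :
    coeff d (elemSchur k) =
      if (wt d : ℤ) = k then (∏ i ∈ d.support, (Nat.factorial (d i) : ℂ))⁻¹ else 0 := by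
  unfold elemSchur
  split_ifs with h1 h2 h2
  · omega
  · simp
  · have hk : k.toNat = wt d := by omega
    rw [finsum_eq_sum_of_support_subset (s := (wt_finite k.toNat).toFinset)]
    · rw [coeff_sum, Finset.sum_eq_single d]
      · rw [if_pos (by rw [hk]; rfl), coeff_monomial, if_pos rfl]
      · intro b _ hb
        split_ifs
        · rw [coeff_monomial, if_neg hb]
        · simp
      · intro hd; exfalso; apply hd; simp [hk]
    · intro b hb
      simp only [Function.mem_support] at hb
      simp only [Set.Finite.coe_toFinset, Set.mem_ofPred_eq]
      by_contra hc; exact hb (if_neg hc)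
  · rw [finsum_eq_sum_of_support_subset (s := (wt_finite k.toNat).toFinset)]
    · rw [coeff_sum, Finset.sum_eq_zero]
      intro b hb
      have hb' : wt b = k.toNat := by simpa using hb
      split_ifs
      · rw [coeff_monomial, if_neg]
        rintro rfl; omega
      · simp
    · intro b hb
      simp only [Function.mem_support] at hb
      simp only [Set.Finite.coe_toFinset, Set.mem_ofPred_eq]
      by_contra hc; exact hb (if_neg hc)

lemma elemSchur_neg {k : ℤ} (h : k < 0) : elemSchur k = 0 := by
  unfold elemSchur; rw [if_pos h]

lemma wt_eq_zero {d : ℕ →₀ ℕ} (h : wt d = 0) : d = 0 := by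
  ext i
  by_contra hc
  have hi : i ∈ d.support := by simpa using hc
  have := Finset.single_le_sum (f := fun i => (i + 1) * d i) (fun _ _ => Nat.zero_le _) hi
  rw [wt, Finsupp.sum] at h
  simp only [Finsupp.coe_zero, Pi.zero_apply] at hc
  have : 1 ≤ d i := Nat.one_le_iff_ne_zero.mpr hc
  nlinarith

lemma wt_zero : wt 0 = 0 := by simp [wt]

lemma elemSchur_zero : elemSchur 0 = 1 := by
  ext d
  rw [coeff_elemSchur, coeff_one]
  by_cases h : d = 0
  · subst h; simp [wt_zero]
  · rw [if_neg, if_neg (Ne.symm h)]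
    intro h2; exact h (wt_eq_zero (by exact_mod_cast h2))

lemma constCoeff_elemSchur (k : ℤ) : constantCoeff (elemSchur k) = if k = 0 then 1 else 0 := by
  rw [constantCoeff_eq, coeff_elemSchur, wt_zero]
  simp [eq_comm]

lemma wt_add_single (d : ℕ →₀ ℕ) (m : ℕ) : wt (d + Finsupp.single m 1) = wt d + (m + 1) := by
  unfold wt
  rw [Finsupp.sum_add_index']
  · simp
  · simp
  · intros; ring

lemma fact_add_single (d : ℕ →₀ ℕ) (m : ℕ) :
    (∏ i ∈ (d + Finsupp.single m 1).support,
      (Nat.factorial ((d + Finsupp.single m 1 : ℕ →₀ ℕ) i) : ℂ)) =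
    (d m + 1) * ∏ i ∈ d.support, (Nat.factorial (d i) : ℂ) := by
  have e1 : ∏ i ∈ d.support, (Nat.factorial (d i) : ℂ) =
      ∏ i ∈ insert m d.support, (Nat.factorial (d i) : ℂ) := by
    apply Finset.prod_subset (Finset.subset_insert _ _)
    intro x _ hx; simp at hx; simp [hx]
  have e2 : (d + Finsupp.single m 1).support = insert m d.support := by
    ext x
    simp only [Finsupp.mem_support_iff, Finsupp.add_apply, Finset.mem_insert, Finsupp.single_apply]
    by_cases h : m = x
    · simp [h]
    · simp [h, Ne.symm h]
  rw [e1, e2, ← Finset.mul_prod_erase _ _ (Finset.mem_insert_self m _),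
    ← Finset.mul_prod_erase _ _ (Finset.mem_insert_self m _), ← mul_assoc]
  congr 1
  · simp [Nat.factorial_succ]
  · apply Finset.prod_congr rfl
    intro x hx
    have : m ≠ x := (Finset.ne_of_mem_erase hx).symm
    simp [this]

lemma pderiv_elemSchur (m : ℕ) (k : ℤ) :
    pderiv m (elemSchur k) = elemSchur (k - (m + 1)) := by
  ext d
  rw [coeff_pderiv, coeff_elemSchur, coeff_elemSchur, wt_add_single, fact_add_single]
  by_cases h : (wt d : ℤ) = k - (m + 1)
  · rw [if_pos h, if_pos (by push_cast; omega), mul_inv]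
    have : (d m + 1 : ℂ) ≠ 0 := Nat.cast_add_one_ne_zero _
    field_simp
  · rw [if_neg h, if_neg (by push_cast; omega)]; simp

lemma deriv_prod {R : Type*} [CommRing R] {A : Type*} [CommRing A] [Algebra R A]
    (D : Derivation R A A) {ι : Type*} (s : Finset ι) (f : ι → A) :
    D (∏ i ∈ s, f i) = ∑ i ∈ s, ∏ j ∈ s, if j = i then D (f j) else f j := by
  induction s using Finset.induction_on with
  | empty => simp
  | insert a s ha ih =>
    rw [Finset.prod_insert ha, D.leibniz, Finset.sum_insert ha, Finset.prod_insert ha, ih]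
    have h1 : ∏ j ∈ s, (if j = a then D (f j) else f j) = ∏ j ∈ s, f j := by
      apply Finset.prod_congr rfl
      intro x hx
      rw [if_neg]; rintro rfl; exact ha hx
    have h2 : ∑ i ∈ s, ∏ j ∈ insert a s, (if j = i then D (f j) else f j) =
        f a * ∑ i ∈ s, ∏ j ∈ s, (if j = i then D (f j) else f j) := by
      rw [Finset.mul_sum]
      apply Finset.sum_congr rfl
      intro x hx
      rw [Finset.prod_insert ha, if_neg]
      rintro rfl; exact ha hx
    rw [h1, h2]; simp only [if_true, smul_eq_mul]; ring

lemma deriv_det {R : Type*} [CommRing R] {A : Type*} [CommRing A] [Algebra R A]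
    (D : Derivation R A A) {N : ℕ} (M : Matrix (Fin N) (Fin N) A) :
    D M.det = ∑ i, Matrix.det (Matrix.of fun r c => if r = i then D (M r c) else M r c) := by
  rw [← Matrix.det_transpose]
  simp_rw [← Matrix.det_transpose (Matrix.of _), Matrix.det_apply, map_sum]
  rw [Finset.sum_comm]
  apply Finset.sum_congr rfl
  intro σ _
  rw [← Finset.smul_sum]
  simp only [Units.smul_def]
  rw [map_zsmul, deriv_prod]
  congr 1
  refine Finset.sum_congr rfl fun i _ => Finset.prod_congr rfl fun j _ => ?_
  simp only [Matrix.transpose_apply, Matrix.of_apply]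
  congr

/-- Generalised Schur determinant. -/
noncomputable def D (N : ℕ) (a : Fin N → ℤ) : MvPolynomial ℕ ℂ :=
  Matrix.det (Matrix.of fun i j : Fin N => elemSchur (a i + (j : ℤ)))

lemma D_perm {N : ℕ} (a : Fin N → ℤ) (σ : Equiv.Perm (Fin N)) :
    D N (a ∘ σ) = ((Equiv.Perm.sign σ : ℤ) : MvPolynomial ℕ ℂ) * D N a := by
  unfold D
  rw [← Matrix.det_permute]
  rfl

lemma D_eq_zero_of_eq {N : ℕ} (a : Fin N → ℤ) {i j : Fin N} (h : i ≠ j) (e : a i = a j) :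
    D N a = 0 := by
  apply Matrix.det_zero_of_row_eq h
  ext c; simp [e]

lemma D_eq_zero_of_le {N : ℕ} (a : Fin N → ℤ) {i : Fin N} (h : a i ≤ -N) : D N a = 0 := by
  apply Matrix.det_eq_zero_of_row_eq_zero i
  intro c
  have := c.2
  exact elemSchur_neg (by omega)

lemma pderiv_D {N : ℕ} (m : ℕ) (a : Fin N → ℤ) :
    pderiv m (D N a) = ∑ i, D N (Function.update a i (a i - (m + 1))) := by
  unfold D
  rw [deriv_det]
  apply Finset.sum_congr rfl
  intro i _
  congr 1
  ext r c : 2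
  simp only [Matrix.of_apply]
  by_cases h : r = i
  · subst h
    rw [if_pos rfl, pderiv_elemSchur, Function.update_self]; congr 1; ring_nf
  · rw [if_neg h, Function.update_of_ne h]

/-- A polynomial with vanishing partial derivatives and constant term is zero. -/
lemma eq_zero_of_pderiv (p : MvPolynomial ℕ ℂ) (h0 : constantCoeff p = 0)
    (h : ∀ m, pderiv m p = 0) : p = 0 := by
  ext d
  by_cases hd : d = 0
  · subst hd; simpa [constantCoeff_eq] using h0
  · obtain ⟨m, hm⟩ := Finsupp.ne_iff.mp hd
    have h1 := congrArg (coeff (d - Finsupp.single m 1)) (h m)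
    rw [coeff_pderiv, tsub_add_cancel_of_le] at h1
    · simp only [coeff_zero] at h1 ⊢
      rcases mul_eq_zero.mp h1 with h2 | h2
      · exact h2
      · exact absurd h2 (Nat.cast_add_one_ne_zero _)
    · rw [Finsupp.single_le_iff]
      exact Nat.one_le_iff_ne_zero.mpr hm

lemma constCoeff_D_update {N : ℕ} (a : Fin N → ℤ) (n : ℕ) (hn : 1 ≤ n) (ha : Function.Injective a)
    (hpos : ∀ i, -(N : ℤ) < a i) (i : Fin N) :
    constantCoeff (D N (Function.update a i (a i + n))) = 0 := by
  unfold D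
  rw [RingHom.map_det]
  by_cases h : 0 < a i
  · apply Matrix.det_eq_zero_of_row_eq_zero i
    intro j
    simp only [RingHom.mapMatrix_apply, Matrix.map_apply, Matrix.of_apply, Function.update_self]
    rw [constCoeff_elemSchur, if_neg]; omega
  · have hp := hpos i
    apply Matrix.det_eq_zero_of_column_eq_zero ⟨(-(a i)).toNat, by omega⟩
    intro k
    simp only [RingHom.mapMatrix_apply, Matrix.map_apply, Matrix.of_apply]
    rw [constCoeff_elemSchur, if_neg]
    by_cases hk : k = i
    · subst hk; rw [Function.update_self]; omega
    · rw [Function.update_of_ne hk]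
      intro h2
      apply hk; apply ha; omega

lemma sum_up_eq_zero {N : ℕ} (b : Fin N → ℤ) (n : ℤ) {j k : Fin N} (hjk : j ≠ k) (e : b j = b k) :
    ∑ i, D N (Function.update b i (b i + n)) = 0 := by
  rw [← Finset.add_sum_erase _ _ (Finset.mem_univ j),
    ← Finset.add_sum_erase _ _ (Finset.mem_erase.mpr ⟨hjk.symm, Finset.mem_univ k⟩),
    Finset.sum_eq_zero]
  · have : Function.update b k (b k + n) = Function.update b j (b j + n) ∘ (Equiv.swap j k) := by
      ext t
      by_cases h1 : t = j
      · subst h1; simp [Function.update_of_ne hjk, Function.update_of_ne hjk.symm, e]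
      · by_cases h2 : t = k
        · subst h2; simp [e]
        · simp [Equiv.swap_apply_of_ne_of_ne h1 h2, Function.update_of_ne h1, Function.update_of_ne h2]
    rw [this, D_perm, Equiv.Perm.sign_swap hjk]
    simp
  · intro i hi
    simp only [Finset.mem_erase, Finset.mem_univ, and_true] at hi
    apply D_eq_zero_of_eq _ hjk
    rw [Function.update_of_ne hi.2.symm, Function.update_of_ne hi.1.symm, e]

/-- The multiplication rule for the generalised determinants. -/
lemma mul_D {N : ℕ} (n : ℕ) (hn : 1 ≤ n) : ∀ (w : ℕ) (a : Fin N → ℤ),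
    (∑ i, (a i + N)) = w →
    Function.Injective a → (∀ i, -(N : ℤ) < a i) →
    (∀ t : ℤ, -(N : ℤ) < t → t ≤ -N + n → ∃ i, a i = t) →
    (n : ℂ) • (X (n - 1) * D N a) = ∑ i, D N (Function.update a i (a i + n)) := by
  intro w
  induction w using Nat.strong_induction_on with
  | _ w ih =>
  intro a hw hinj hpos hrange
  rw [← sub_eq_zero]
  apply eq_zero_of_pderiv
  · rw [map_sub, map_sum, Finset.sum_eq_zero (fun i _ => constCoeff_D_update a n hn hinj hpos i)]
    rw [smul_eq_C_mul]
    simp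
  intro m
  -- the individual contributions
  have hj : ∀ j : Fin N,
      (∑ i, D N (Function.update (Function.update a i (a i + n)) j
        ((Function.update a i (a i + n)) j - (m + 1)))) =
      (n : ℂ) • (X (n - 1) * D N (Function.update a j (a j - (m + 1)))) +
      (if n - 1 = m ∧ a j ≤ -N + n then D N a else 0) := by
    intro j
    have hcomm : ∀ i, Function.update (Function.update a i (a i + n)) j
        ((Function.update a i (a i + n)) j - (m + 1)) =
        Function.update (Function.update a j (a j - (m + 1))) i
        ((Function.update a j (a j - (m + 1))) i + n) := by
      intro i
      by_cases hij : i = j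
      · subst hij; simp; ring_nf
      · rw [Function.update_comm (Ne.symm hij) ]
        simp [Function.update_of_ne hij, Function.update_of_ne (Ne.symm hij)]
    simp_rw [hcomm]
    set b := Function.update a j (a j - (m + 1)) with hb
    have hbj : b j = a j - (m + 1) := by simp [hb]
    have hbo : ∀ k, k ≠ j → b k = a k := fun k hk => by simp [hb, Function.update_of_ne hk]
    by_cases h1 : a j - (m + 1) ≤ -N
    · rw [D_eq_zero_of_le b (hbj.trans_le h1), mul_zero, smul_zero, zero_add,
        Finset.sum_eq_single j]
      · have hpj := hpos j
        have hupd : Function.update b j (b j + n) = Function.update a j (a j - (m + 1) + n) := by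
          rw [hbj, hb, Function.update_idem]
        rw [hupd]
        split_ifs with h2
        · congr 1
          rw [show a j - (m + 1) + n = a j by omega, Function.update_eq_self]
        · by_cases h3 : a j - (m + 1) + n ≤ -N
          · apply D_eq_zero_of_le (i := j); simpa using h3
          · obtain ⟨k, hk⟩ := hrange (a j - (m + 1) + n) (by omega) (by omega)
            have hkj : k ≠ j := by
              rintro rfl
              omega
            apply D_eq_zero_of_eq _ hkj
            rw [Function.update_of_ne hkj, Function.update_self, hk]
      · intro i _ hij
        apply D_eq_zero_of_le (i := j)
        rw [Function.update_of_ne (Ne.symm hij), hbj]; exact h1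
      · simp
    · rw [if_neg (by omega), add_zero]
      by_cases h2 : ∃ k, k ≠ j ∧ a k = a j - (m + 1)
      · obtain ⟨k, hkj, hk⟩ := h2
        have e : b k = b j := by rw [hbj, hbo k hkj, hk]
        rw [sum_up_eq_zero b n hkj e, D_eq_zero_of_eq b hkj e]
        simp
      · push Not at h2
        symm
        refine ih (∑ i, (b i + N)).toNat ?_ b ?_ ?_ ?_ ?_
        · have h3 : ∑ i, (b i + N) = ∑ i, (a i + N) - (m + 1) := by
            rw [← Finset.add_sum_erase _ _ (Finset.mem_univ j),
              ← Finset.add_sum_erase (a := j) (f := fun i => a i + (N : ℤ)) _ (Finset.mem_univ j), hbj,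
              Finset.sum_congr rfl (g := fun i => a i + (N : ℤ))]
            · ring
            · intro x hx; rw [hbo x (Finset.ne_of_mem_erase hx)]
          have h4 : 0 ≤ ∑ i, (b i + N) := by
            apply Finset.sum_nonneg
            intro i _
            by_cases hij : i = j
            · subst hij; omega
            · rw [hbo i hij]; have := hpos i; omega
          omega
        · rw [Int.toNat_of_nonneg]
          apply Finset.sum_nonneg
          intro i _
          by_cases hij : i = j
          · subst hij; omega
          · rw [hbo i hij]; have := hpos i; omega
        · intro x y hxy
          by_cases hx : x = j <;> by_cases hy : y = j
          · rw [hx, hy]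
          · subst hx; rw [hbj, hbo y hy] at hxy; exact absurd hxy.symm (h2 y hy)
          · subst hy; rw [hbj, hbo x hx] at hxy; exact absurd hxy (h2 x hx)
          · rw [hbo x hx, hbo y hy] at hxy; exact hinj hxy
        · intro i
          by_cases hij : i = j
          · subst hij; omega
          · rw [hbo i hij]; exact hpos i
        · intro t ht1 ht2
          obtain ⟨i, hi⟩ := hrange t ht1 ht2
          by_cases hij : i = j
          · subst hij
            obtain ⟨k, hk⟩ := hrange (a i - (m + 1)) (by omega) (by omega)
            by_cases hki : k = i
            · subst hki; omega
            · exact absurd hk (h2 k hki)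
          · exact ⟨i, by rw [hbo i hij, hi]⟩
  rw [map_sub, map_sum, Derivation.map_smul, Derivation.leibniz]
  simp_rw [pderiv_D]
  rw [Finset.sum_comm, Finset.sum_congr rfl (fun j _ => hj j), Finset.sum_add_distrib,
    ← Finset.smul_sum, ← Finset.mul_sum, ← Finset.sum_filter, smul_add, smul_eq_mul,
    add_sub_add_left_eq_sub, sub_eq_zero, pderiv_X]
  by_cases hm : n - 1 = m
  · subst hm
    simp only [true_and, Pi.single_eq_same, smul_eq_mul, mul_one, Finset.sum_const]
    have hcard : (Finset.univ.filter (fun j => a j ≤ -(N : ℤ) + n)).card = n := by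
      have : (Finset.univ.filter (fun j => a j ≤ -(N : ℤ) + n)).image a =
          Finset.Ioc (-(N : ℤ)) (-N + n) := by
        ext t
        simp only [Finset.mem_image, Finset.mem_filter, Finset.mem_univ, true_and, Finset.mem_Ioc]
        constructor
        · rintro ⟨i, hi, rfl⟩; exact ⟨hpos i, hi⟩
        · rintro ⟨h1, h2⟩
          obtain ⟨i, rfl⟩ := hrange t h1 h2
          exact ⟨i, h2, rfl⟩
      rw [← Finset.card_image_of_injective _ hinj, this]
      simp
    rw [hcard, Nat.cast_smul_eq_nsmul]
  · simp [hm]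

end BF

namespace BF

/-- Shifted row lengths `λ_t - t`. -/
def beta (lam : YoungDiagram) (t : ℕ) : ℤ := (lam.rowLen t : ℤ) - t

lemma beta_strictAnti (lam : YoungDiagram) : StrictAnti (beta lam) := by
  apply strictAnti_nat_of_succ_lt
  intro t
  have := lam.rowLen_anti t (t + 1) (Nat.le_succ t)
  unfold beta; push_cast; omega

lemma beta_ge (lam : YoungDiagram) (t : ℕ) : -(t : ℤ) ≤ beta lam t := by
  unfold beta; omega

lemma rowLen_pos_iff (lam : YoungDiagram) (t : ℕ) : 0 < lam.rowLen t ↔ t < lam.colLen 0 := by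
  rw [← YoungDiagram.mem_iff_lt_rowLen, YoungDiagram.mem_iff_lt_colLen]

lemma beta_of_ge (lam : YoungDiagram) {t : ℕ} (h : lam.colLen 0 ≤ t) : beta lam t = -t := by
  have := rowLen_pos_iff lam t
  unfold beta; omega

lemma colLen_le_of (lam : YoungDiagram) {N : ℕ} (h : beta lam N = -N) : lam.colLen 0 ≤ N := by
  have := rowLen_pos_iff lam N
  unfold beta at h; omega

lemma beta_inj {lam mu : YoungDiagram} (h : ∀ t, beta lam t = beta mu t) : lam = mu := by
  ext ⟨t, s⟩
  rw [YoungDiagram.mem_cells, YoungDiagram.mem_cells, YoungDiagram.mem_iff_lt_rowLen,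
    YoungDiagram.mem_iff_lt_rowLen]
  have := h t
  unfold beta at this; omega

lemma exists_diagram (b : ℕ → ℤ) (hb : StrictAnti b) (N : ℕ) (hN : ∀ t, N ≤ t → b t = -t) :
    ∃ mu : YoungDiagram, ∀ t, beta mu t = b t := by
  have hstep : ∀ t, b (t + 1) + 1 ≤ b t := fun t => hb (Nat.lt_succ_self t)
  have hanti : Antitone (fun t : ℕ => b t + t) := by
    apply antitone_nat_of_succ_le
    intro t; have := hstep t; push_cast; omega
  have hnn : ∀ t, 0 ≤ b t + t := by
    intro t
    have h1 := hanti (le_max_left t N)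
    have h2 := hN (max t N) (le_max_right t N)
    simp only at h1; omega
  let mu : YoungDiagram :=
    { cells := (Finset.range N ×ˢ Finset.range (b 0).toNat).filter (fun p => (p.2 : ℤ) < b p.1 + p.1)
      isLowerSet := by
        rintro ⟨t, s⟩ ⟨t', s'⟩ h hm
        simp only [Prod.mk_le_mk] at h
        simp only [Finset.coe_filter, Finset.mem_product, Finset.mem_range, Set.mem_ofPred_eq] at hm ⊢
        have := hanti h.1
        simp only at this
        omega }
  refine ⟨mu, fun t => ?_⟩
  have hmem : ∀ s, (t, s) ∈ mu ↔ (s : ℤ) < b t + t := by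
    intro s
    rw [← YoungDiagram.mem_cells]
    simp only [mu, Finset.mem_filter, Finset.mem_product, Finset.mem_range, and_iff_right_iff_imp]
    intro h
    have h0 := hanti (Nat.zero_le t)
    simp only at h0
    have := hN t
    omega
  have h1 := hmem (mu.rowLen t)
  have h2 := hmem (b t + t).toNat
  rw [YoungDiagram.mem_iff_lt_rowLen] at h1 h2
  have := hnn t
  unfold beta; omega

lemma mem_interval (m : ℕ) (x c : ℤ) :
    c ∈ ((Finset.range m).image (fun t => x + (t : ℤ)) : Finset ℤ) ↔ x ≤ c ∧ c < x + m := by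
  simp only [Finset.mem_image, Finset.bind_def, Finset.pure_def, Finset.mem_sup, Finset.mem_range,
    Finset.mem_singleton]
  constructor
  · rintro ⟨t, ⟨s, h1, rfl⟩, rfl⟩; omega
  · rintro ⟨h1, h2⟩; exact ⟨c - x, ⟨(c - x).toNat, by omega, by omega⟩, by omega⟩

/-- Explicit description of removing a rim hook. -/
def Mv (n : ℕ) (i k : ℕ) (a b : ℕ → ℤ) : Prop :=
  i ≤ k ∧ (∀ t, t < i → b t = a t) ∧ (∀ t, k < t → b t = a t) ∧
    (∀ t, i ≤ t → t < k → b t = a (t + 1)) ∧ b k = a i - n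

lemma Mv.lt {n i k : ℕ} {a b : ℕ → ℤ} (h : Mv n i k a b) (hn : 1 ≤ n) (ha : StrictAnti a)
    (hb : StrictAnti b) {t : ℕ} (h1 : i ≤ t) (h2 : t ≤ k) : b t < a t := by
  obtain ⟨h0, hl, hg, hm, hk⟩ := h
  rcases Nat.lt_or_eq_of_le h2 with h3 | h3
  · rw [hm t h1 h3]; exact ha (Nat.lt_succ_self t)
  · subst h3
    rcases Nat.lt_or_eq_of_le h0 with h4 | h4
    · obtain ⟨s, rfl⟩ : ∃ s, t = s + 1 := ⟨t - 1, by omega⟩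
      rw [← hm s (by omega) (by omega)]; exact hb (Nat.lt_succ_self s)
    · subst h4; omega

lemma mem_skew {mu lam : YoungDiagram} (p : ℕ × ℕ) :
    p ∈ lam.cells \ mu.cells ↔
      beta mu p.1 ≤ (p.2 : ℤ) - p.1 ∧ (p.2 : ℤ) - p.1 < beta lam p.1 := by
  obtain ⟨t, s⟩ := p
  rw [Finset.mem_sdiff, YoungDiagram.mem_cells, YoungDiagram.mem_cells,
    YoungDiagram.mem_iff_lt_rowLen, YoungDiagram.mem_iff_lt_rowLen]
  unfold beta
  simp only; omega

lemma row_skew {mu lam : YoungDiagram} {t : ℕ} {c : ℤ} (h1 : beta mu t ≤ c) (h2 : c < beta lam t) :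
    ∃ p ∈ lam.cells \ mu.cells, p.1 = t ∧ (p.2 : ℤ) - p.1 = c := by
  have := beta_ge mu t
  refine ⟨(t, (c + t).toNat), ?_, rfl, ?_⟩
  · rw [mem_skew]; simp only; omega
  · simp only; omega

lemma hookStep_of_Mv {n i k : ℕ} (hn : 1 ≤ n) {mu lam : YoungDiagram}
    (h : Mv n i k (beta lam) (beta mu)) :
    hookStep n mu lam ∧ skewL (lam.cells \ mu.cells) = k - i := by
  have ha := beta_strictAnti lam
  have hb := beta_strictAnti mu
  have hlt := fun t => h.lt hn ha hb (t := t)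
  obtain ⟨h0, hl, hg, hm, hk⟩ := h
  have hrow : ∀ p ∈ lam.cells \ mu.cells, i ≤ p.1 ∧ p.1 ≤ k := by
    intro p hp
    rw [mem_skew] at hp
    constructor
    · by_contra hc; have := hl p.1 (by omega); omega
    · by_contra hc; have := hg p.1 (by omega); omega
  have hinj : Set.InjOn (fun p : ℕ × ℕ => (p.2 : ℤ) - (p.1 : ℤ)) (lam.cells \ mu.cells : Finset (ℕ × ℕ)) := by
    have key : ∀ p ∈ lam.cells \ mu.cells, ∀ q ∈ lam.cells \ mu.cells, p.1 < q.1 →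
        (p.2 : ℤ) - p.1 ≠ (q.2 : ℤ) - q.1 := by
      intro p hp q hq hpq he
      have r1 := hrow p hp
      have r2 := hrow q hq
      rw [mem_skew] at hp hq
      have e := hm p.1 r1.1 (by omega)
      have := ha.antitone (show p.1 + 1 ≤ q.1 from hpq)
      omega
    intro p hp q hq he
    have hp' := Finset.mem_coe.mp hp
    have hq' := Finset.mem_coe.mp hq
    simp only at he
    rcases lt_trichotomy p.1 q.1 with h | h | h
    · exact absurd he (key p hp' q hq' h)
    · ext
      · exact h
      · omega
    · exact absurd he.symm (key q hq' p hp' h)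
  have hcont : contentsOf (lam.cells \ mu.cells) = Finset.Ico (beta mu k) (beta lam i) := by
    ext c
    simp only [contentsOf, Finset.mem_image, Finset.mem_Ico]
    constructor
    · rintro ⟨p, hp, rfl⟩
      have r1 := hrow p hp
      rw [mem_skew] at hp
      have e1 := ha.antitone r1.1
      have e2 := hb.antitone r1.2
      omega
    · rintro ⟨c1, c2⟩
      -- the last row whose beta exceeds c
      have hP : c < beta lam (Nat.findGreatest (fun t => c < beta lam t) k) :=
        Nat.findGreatest_spec (P := fun t => c < beta lam t) h0 c2
      have hge : i ≤ Nat.findGreatest (fun t => c < beta lam t) k := Nat.le_findGreatest h0 c2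
      have hle : Nat.findGreatest (fun t => c < beta lam t) k ≤ k := Nat.findGreatest_le k
      have hnot : ∀ s, Nat.findGreatest (fun t => c < beta lam t) k < s → s ≤ k → ¬ c < beta lam s :=
        fun s h1 h2 => Nat.findGreatest_is_greatest h1 h2
      generalize Nat.findGreatest (fun t => c < beta lam t) k = t at hP hge hle hnot
      have hbt : beta mu t ≤ c := by
        rcases Nat.lt_or_eq_of_le hle with h3 | h3
        · rw [hm t hge h3]
          have := hnot (t + 1) (by omega) (by omega)
          omega
        · rw [h3]; exact c1
      obtain ⟨p, hp, _, h2⟩ := row_skew hbt hP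
      exact ⟨p, hp, h2⟩
  have hcc : (contentsOf (lam.cells \ mu.cells)).card = (lam.cells \ mu.cells).card :=
    Finset.card_image_of_injOn hinj
  have hcard : (lam.cells \ mu.cells).card = n := by
    rw [← hcc, hcont, Int.card_Ico]; omega
  have hle : mu ≤ lam := by
    rw [← YoungDiagram.cells_subset_iff]
    rintro ⟨t, s⟩ hp
    rw [YoungDiagram.mem_cells, YoungDiagram.mem_iff_lt_rowLen] at hp ⊢
    have : beta mu t ≤ beta lam t := by
      by_cases h1 : t < i
      · exact (hl t h1).le
      · by_cases h2 : k < t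
        · exact (hg t h2).le
        · exact (hlt t (by omega) (by omega)).le
    unfold beta at this; omega
  refine ⟨⟨hle, hcard, ?_, hcc, beta mu k, ?_⟩, ?_⟩
  · rw [← Finset.card_pos]; omega
  · rw [hcard, hcont]
    ext c
    rw [mem_interval, Finset.mem_Ico]; omega
  · have : (lam.cells \ mu.cells).image Prod.fst = Finset.Icc i k := by
      ext t
      simp only [Finset.mem_image, Finset.mem_Icc]
      constructor
      · rintro ⟨p, hp, rfl⟩; exact hrow p hp
      · rintro ⟨h1, h2⟩
        obtain ⟨p, hp, h3, _⟩ := row_skew (le_refl _) (hlt t h1 h2)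
        exact ⟨p, hp, h3⟩
    rw [skewL, this, Nat.card_Icc]; omega

lemma Mv_of_hookStep {n : ℕ} {mu lam : YoungDiagram} (h : hookStep n mu lam) :
    ∃ i k, Mv n i k (beta lam) (beta mu) := by
  obtain ⟨hle, hcard, hne, hcc, x, hx⟩ := h
  have ha := beta_strictAnti lam
  have hb := beta_strictAnti mu
  have hba : ∀ t, beta mu t ≤ beta lam t := by
    intro t
    by_contra hc
    have h1 : (t, lam.rowLen t) ∈ mu := by
      rw [YoungDiagram.mem_iff_lt_rowLen]; unfold beta at hc; omega
    have h2 := hle h1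
    rw [YoungDiagram.mem_iff_lt_rowLen] at h2
    omega
  have hinj := Finset.card_image_iff.mp hcc
  have hxm : ∀ c, (∃ t, beta mu t ≤ c ∧ c < beta lam t) ↔ x ≤ c ∧ c < x + n := by
    intro c
    have h1 : c ∈ contentsOf (lam.cells \ mu.cells) ↔ x ≤ c ∧ c < x + n := by
      rw [hx, hcard]
      exact mem_interval n x c
    rw [← h1]
    simp only [contentsOf, Finset.mem_image]
    constructor
    · rintro ⟨t, h2, h3⟩
      obtain ⟨p, hp, _, h4⟩ := row_skew h2 h3
      exact ⟨p, hp, h4⟩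
    · rintro ⟨p, hp, rfl⟩
      rw [mem_skew] at hp
      exact ⟨p.1, hp⟩
  have hdisj : ∀ t, beta lam (t + 1) ≤ beta mu t := by
    intro t
    by_contra hc
    have h1 := ha (Nat.lt_succ_self t)
    have h2 := hb (Nat.lt_succ_self t)
    simp only [Nat.succ_eq_add_one] at h1 h2
    obtain ⟨p, hp, hp1, hp2⟩ := row_skew (mu := mu) (lam := lam) (t := t) (c := beta lam (t + 1) - 1)
      (by omega) (by omega)
    obtain ⟨q, hq, hq1, hq2⟩ := row_skew (mu := mu) (lam := lam) (t := t + 1)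
      (c := beta lam (t + 1) - 1) (by omega) (by omega)
    have := hinj (Finset.mem_coe.mpr hp) (Finset.mem_coe.mpr hq) (by simp only; omega)
    rw [this] at hp1; omega
  have himg : ((lam.cells \ mu.cells).image Prod.fst).Nonempty := hne.image _
  set i := ((lam.cells \ mu.cells).image Prod.fst).min' himg with hi
  set k := ((lam.cells \ mu.cells).image Prod.fst).max' himg with hk
  have hrow : ∀ t, beta mu t < beta lam t → i ≤ t ∧ t ≤ k := by
    intro t ht
    obtain ⟨p, hp, hp1, _⟩ := row_skew (le_refl _) ht
    have : t ∈ (lam.cells \ mu.cells).image Prod.fst := Finset.mem_image.mpr ⟨p, hp, hp1⟩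
    exact ⟨Finset.min'_le _ _ this, Finset.le_max' _ _ this⟩
  have hmemrow : ∀ t ∈ (lam.cells \ mu.cells).image Prod.fst, beta mu t < beta lam t := by
    intro t ht
    obtain ⟨p, hp, rfl⟩ := Finset.mem_image.mp ht
    rw [mem_skew] at hp; omega
  have hir := hmemrow i (Finset.min'_mem _ _)
  have hkr := hmemrow k (Finset.max'_mem _ _)
  have hik : i ≤ k := (hrow i hir).2
  clear_value i k
  have hmid : ∀ t, i ≤ t → t < k → beta mu t = beta lam (t + 1) := by
    intro t h1 h2
    by_contra hc
    have h3 := hdisj t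
    have e1 := (hxm (beta lam i - 1)).mp ⟨i, by omega, by omega⟩
    have e2 := (hxm (beta mu k)).mp ⟨k, by omega, by omega⟩
    have e3 := hb.antitone h1
    have e4 := ha.antitone (show t + 1 ≤ k from h2)
    obtain ⟨s, hs1, hs2⟩ := (hxm (beta mu t - 1)).mpr (by omega)
    rcases Nat.lt_or_ge t s with h4 | h4
    · have := ha.antitone (show t + 1 ≤ s from h4); omega
    · have := hb.antitone h4; omega
  refine ⟨i, k, hik, ?_, ?_, hmid, ?_⟩
  · intro t ht
    have := hrow t; have := hba t; omega
  · intro t ht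
    have := hrow t; have := hba t; omega
  · have e1 := (hxm (beta lam i - 1)).mp ⟨i, by omega, by omega⟩
    have e2 := (hxm (beta mu k)).mp ⟨k, by omega, by omega⟩
    obtain ⟨s, hs1, hs2⟩ := (hxm x).mpr (by omega)
    have r1 := hrow s (by omega)
    have := hb.antitone r1.2
    obtain ⟨u, hu1, hu2⟩ := (hxm (x + n - 1)).mpr (by omega)
    have r2 := hrow u (by omega)
    have := ha.antitone r2.1
    omega

end BF

namespace BF

open MvPolynomial

lemma D_succ {N : ℕ} (a : ℕ → ℤ) (h : a N = -N) :
    D (N + 1) (fun i => a i) = D N (fun i => a i) := by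
  unfold D
  rw [Matrix.det_succ_row _ (Fin.last N), Finset.sum_eq_single (Fin.last N)]
  · simp only [Matrix.of_apply, Fin.val_last, h]
    rw [show -(N : ℤ) + N = 0 by ring, elemSchur_zero]
    have : (-1 : MvPolynomial ℕ ℂ) ^ (N + N) = 1 := Even.neg_one_pow ⟨N, rfl⟩
    rw [this, one_mul, one_mul]
    congr 1
    ext r c : 2
    simp [Matrix.submatrix_apply]
  · intro j _ hj
    have hj' : (j : ℕ) < N := by
      have h1 := j.2
      have h2 : (j : ℕ) ≠ N := fun h => hj (Fin.ext h)
      omega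
    simp only [Matrix.of_apply, Fin.val_last, h]
    rw [elemSchur_neg (by omega)]; simp
  · simp

lemma schurPoly_eq (lam : YoungDiagram) {N : ℕ} (h : lam.colLen 0 ≤ N) :
    schurPoly lam = D N (fun i => beta lam i) := by
  induction N, h using Nat.le_induction with
  | base =>
    unfold schurPoly D
    congr 1
    ext r c : 2
    simp only [Matrix.of_apply, beta]
    congr 1; ring_nf
  | succ N hN ih => rw [ih, D_succ _ (beta_of_ge lam hN)]

lemma Mv.D_down {n i k N : ℕ} {a b : ℕ → ℤ} (h : Mv n i k a b) (hk : k < N) (hi : i < N) :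
    D N (Function.update (fun t : Fin N => a t) ⟨i, hi⟩ (a i - n)) =
      (-1 : ℂ) ^ (k - i) • D N (fun t => b t) := by
  have : NeZero N := ⟨by omega⟩
  obtain ⟨h0, hl, hg, hm, hk'⟩ := h
  have hle : (⟨i, hi⟩ : Fin N) ≤ ⟨k, hk⟩ := h0
  have : (fun t : Fin N => b t) = Function.update (fun t : Fin N => a t) ⟨i, hi⟩ (a i - n) ∘
      Fin.cycleIcc ⟨i, hi⟩ ⟨k, hk⟩ := by
    ext t
    simp only [Function.comp_apply]
    rcases lt_or_ge t ⟨i, hi⟩ with h1 | h1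
    · rw [Fin.cycleIcc_of_lt h1, Function.update_of_ne h1.ne, hl t h1]
    · rcases lt_trichotomy t ⟨k, hk⟩ with h2 | h2 | h2
      · rw [Fin.cycleIcc_of_ge_of_lt h1 h2]
        have h1' : i ≤ t := h1
        have h2' : (t : ℕ) < k := h2
        have hv : ((t + 1 : Fin N) : ℕ) = t + 1 := Fin.val_add_one_of_lt' (by omega)
        rw [Function.update_of_ne, hm t h1' h2', hv]
        intro hc
        have := congrArg Fin.val hc
        rw [hv] at this; simp only at this; omega
      · rw [h2, Fin.cycleIcc_of_last hle, Function.update_self, hk']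
      · rw [Fin.cycleIcc_of_gt h2, Function.update_of_ne (hle.trans_lt h2).ne', hg t h2]
  rw [this, D_perm, Fin.sign_cycleIcc_of_le hle, smul_eq_C_mul, ← mul_assoc]
  simp [← mul_pow]

lemma Mv.D_up {n i k N : ℕ} {a b : ℕ → ℤ} (h : Mv n i k a b) (hk : k < N) (hi : i < N) :
    D N (Function.update (fun t : Fin N => b t) ⟨k, hk⟩ (b k + n)) =
      (-1 : ℂ) ^ (k - i) • D N (fun t => a t) := by
  have : NeZero N := ⟨by omega⟩
  obtain ⟨h0, hl, hg, hm, hk'⟩ := h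
  have hle : (⟨i, hi⟩ : Fin N) ≤ ⟨k, hk⟩ := h0
  have : Function.update (fun t : Fin N => b t) ⟨k, hk⟩ (b k + n) = (fun t : Fin N => a t) ∘
      Fin.cycleIcc ⟨i, hi⟩ ⟨k, hk⟩ := by
    ext t
    simp only [Function.comp_apply]
    rcases lt_or_ge t ⟨i, hi⟩ with h1 | h1
    · rw [Fin.cycleIcc_of_lt h1, Function.update_of_ne (h1.trans_le hle).ne, hl t h1]
    · rcases lt_trichotomy t ⟨k, hk⟩ with h2 | h2 | h2
      · rw [Fin.cycleIcc_of_ge_of_lt h1 h2]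
        have h1' : i ≤ t := h1
        have h2' : (t : ℕ) < k := h2
        have hv : ((t + 1 : Fin N) : ℕ) = t + 1 := Fin.val_add_one_of_lt' (by omega)
        rw [Function.update_of_ne h2.ne, hm t h1' h2', hv]
      · rw [h2, Fin.cycleIcc_of_last hle, Function.update_self, hk']; ring
      · rw [Fin.cycleIcc_of_gt h2, Function.update_of_ne h2.ne', hg t h2]
  rw [this, D_perm, Fin.sign_cycleIcc_of_le hle, smul_eq_C_mul]
  simp

lemma Mv.notMem_a {n i k : ℕ} {a b : ℕ → ℤ} (h : Mv n i k a b) (hn : 1 ≤ n) (ha : StrictAnti a)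
    (hb : StrictAnti b) (t : ℕ) : a t ≠ b k := by
  have hlt := h.lt hn ha hb h.1 (le_refl k)
  obtain ⟨h0, hl, hg, hm, hk⟩ := h
  rcases Nat.lt_or_ge k t with h1 | h1
  · rw [← hg t h1]; exact (hb h1).ne
  · have := ha.antitone h1; omega

lemma Mv.notMem_b {n i k : ℕ} {a b : ℕ → ℤ} (h : Mv n i k a b) (hn : 1 ≤ n) (ha : StrictAnti a)
    (hb : StrictAnti b) (t : ℕ) : b t ≠ a i := by
  have hlt := h.lt hn ha hb (le_refl i) h.1
  obtain ⟨h0, hl, hg, hm, hk⟩ := h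
  rcases Nat.lt_or_ge t i with h1 | h1
  · rw [hl t h1]; exact (ha h1).ne'
  · have := hb.antitone h1; omega

lemma exists_down (lam : YoungDiagram) (n N : ℕ) (hn : 1 ≤ n) (hN : lam.colLen 0 ≤ N) (i : ℕ)
    (hx : -(N : ℤ) < beta lam i - n) (hnm : ∀ t < N, beta lam t ≠ beta lam i - n) :
    ∃ mu k, k < N ∧ mu.colLen 0 ≤ N ∧ Mv n i k (beta lam) (beta mu) := by
  have ha := beta_strictAnti lam
  have hbig : ∀ t, N ≤ t → beta lam t = -t := fun t ht => beta_of_ge lam (hN.trans ht)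
  set a := beta lam
  have hiN : i < N := by
    by_contra hc; have := hbig i (by omega); omega
  have hP : a i - n < a (Nat.findGreatest (fun t => a i - n < a t) N) :=
    Nat.findGreatest_spec (P := fun t => a i - n < a t) hiN.le (by omega)
  have hge : i ≤ Nat.findGreatest (fun t => a i - n < a t) N := Nat.le_findGreatest hiN.le (by omega)
  have hle : Nat.findGreatest (fun t => a i - n < a t) N ≤ N := Nat.findGreatest_le N
  have hnot : ∀ s, Nat.findGreatest (fun t => a i - n < a t) N < s → s ≤ N → ¬ a i - n < a s :=
    fun s h1 h2 => Nat.findGreatest_is_greatest h1 h2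
  generalize Nat.findGreatest (fun t => a i - n < a t) N = k at hP hge hle hnot
  have hkN : k < N := by
    by_contra hc
    have := hbig k (by omega); omega
  have hk1 : a (k + 1) < a i - n := by
    have h1 := hnot (k + 1) (by omega) (by omega)
    by_cases h2 : k + 1 < N
    · have := hnm (k + 1) h2; omega
    · have := hbig (k + 1) (by omega); push_cast at this; omega
  have hstep : ∀ t, a (t + 1) < a t := fun t => ha (Nat.lt_succ_self t)
  let b : ℕ → ℤ := fun t => if t < i then a t else if t < k then a (t + 1) else
    if t = k then a i - n else a t
  have hb : StrictAnti b := by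
    apply strictAnti_nat_of_succ_lt
    intro t
    have s1 := hstep t
    have s2 := hstep (t + 1)
    simp only [b]
    rcases Nat.lt_trichotomy t k with h1 | h1 | h1
    · rcases Nat.lt_or_ge (t + 1) k with h2 | h2
      · split_ifs <;> omega
      · obtain rfl : t + 1 = k := by omega
        split_ifs <;> omega
    · subst h1
      split_ifs <;> omega
    · split_ifs <;> omega
  have hbbig : ∀ t, N ≤ t → b t = -t := by
    intro t ht
    have := hbig t ht
    simp only [b]; split_ifs <;> omega
  obtain ⟨mu, hmu⟩ := exists_diagram b hb N hbbig
  refine ⟨mu, k, hkN, colLen_le_of mu (by rw [hmu, hbbig N le_rfl]), hge, ?_, ?_, ?_, ?_⟩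
  · intro t ht; rw [hmu]; simp [b, ht]
  · intro t ht; rw [hmu]; simp only [b]; split_ifs <;> omega
  · intro t h1 h2; rw [hmu]; simp only [b]; split_ifs <;> omega
  · rw [hmu]; simp only [b]; split_ifs <;> omega

lemma exists_up (lam : YoungDiagram) (n N : ℕ) (hn : 1 ≤ n) (hN : lam.colLen 0 ≤ N) (k : ℕ)
    (hkN : k < N) (hnm : ∀ t < N, beta lam t ≠ beta lam k + n) :
    ∃ nu i, i ≤ k ∧ nu.colLen 0 ≤ N ∧ Mv n i k (beta nu) (beta lam) := by
  have hb := beta_strictAnti lam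
  have hbig : ∀ t, N ≤ t → beta lam t = -t := fun t ht => beta_of_ge lam (hN.trans ht)
  set b := beta lam
  have hex : ∃ t, b t < b k + n := ⟨k, by omega⟩
  have hP := Nat.find_spec hex
  have hle : Nat.find hex ≤ k := Nat.find_min' hex (by omega)
  have hnot : ∀ s, s < Nat.find hex → ¬ b s < b k + n := fun s hs => Nat.find_min hex hs
  generalize Nat.find hex = i at hP hle hnot
  have hgt : ∀ s, s < i → b k + n < b s := by
    intro s hs
    have := hnot s hs
    have := hnm s (by omega)
    omega
  have hstep : ∀ t, b (t + 1) < b t := fun t => hb (Nat.lt_succ_self t)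
  let a : ℕ → ℤ := fun t => if t < i then b t else if t = i then b k + n else
    if t ≤ k then b (t - 1) else b t
  have ha : StrictAnti a := by
    apply strictAnti_nat_of_succ_lt
    intro t
    have s1 := hstep t
    have s2 := hstep (t - 1)
    have s3 := hgt t
    simp only [a]
    rcases Nat.lt_trichotomy t i with h1 | h1 | h1
    · split_ifs <;> omega
    · subst h1
      simp only [Nat.add_sub_cancel]
      split_ifs <;> omega
    · rw [show t - 1 + 1 = t by omega] at s2
      simp only [Nat.add_sub_cancel]
      split_ifs <;> omega
  have habig : ∀ t, N ≤ t → a t = -t := by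
    intro t ht
    have := hbig t ht
    simp only [a]; split_ifs <;> omega
  obtain ⟨nu, hnu⟩ := exists_diagram a ha N habig
  refine ⟨nu, i, hle, colLen_le_of nu (by rw [hnu, habig N le_rfl]), hle, ?_, ?_, ?_, ?_⟩
  · intro t ht; rw [hnu]; simp [a, ht]
  · intro t ht; rw [hnu]; simp only [a]; split_ifs <;> omega
  · intro t h1 h2; rw [hnu]; simp only [a, Nat.add_sub_cancel]; split_ifs <;> omega
  · rw [hnu]; simp [a]

lemma Mv.i_unique {n i k i' k' : ℕ} {a b : ℕ → ℤ} (h : Mv n i k a b) (h' : Mv n i' k' a b)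
    (hn : 1 ≤ n) (ha : StrictAnti a) (hb : StrictAnti b) : i = i' := by
  have e1 := h.lt hn ha hb (le_refl i) h.1
  have e2 := h'.lt hn ha hb (le_refl i') h'.1
  have e3 := h.2.1 i'
  have e4 := h'.2.1 i
  omega

lemma Mv.k_unique {n i k i' k' : ℕ} {a b : ℕ → ℤ} (h : Mv n i k a b) (h' : Mv n i' k' a b)
    (hn : 1 ≤ n) (ha : StrictAnti a) (hb : StrictAnti b) : k = k' := by
  have e1 := h.lt hn ha hb h.1 (le_refl k)
  have e2 := h'.lt hn ha hb h'.1 (le_refl k')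
  have e3 := h.2.2.1 k'
  have e4 := h'.2.2.1 k
  omega

lemma Mv.b_unique {n i k k' : ℕ} {a b b' : ℕ → ℤ} (h : Mv n i k a b) (h' : Mv n i k' a b')
    (hn : 1 ≤ n) (ha : StrictAnti a) (hb : StrictAnti b) (hb' : StrictAnti b') (t : ℕ) :
    b t = b' t := by
  have key : ∀ {k k' : ℕ} {b b' : ℕ → ℤ}, Mv n i k a b → Mv n i k' a b' → StrictAnti b →
      StrictAnti b' → ¬ k < k' := by
    intro k k' b b' h h' hb hb' hlt
    have e1 := h'.lt hn ha hb' h'.1 (le_refl k')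
    have e2 := hb hlt
    have e3 := h.2.2.1 k' hlt
    have e4 := h.2.2.2.2
    have e5 := h'.2.2.2.2
    omega
  obtain rfl : k = k' := by
    have := key h h' hb hb'
    have := key h' h hb' hb
    omega
  obtain ⟨h0, hl, hg, hm, hk⟩ := h
  obtain ⟨_, hl', hg', hm', hk'⟩ := h'
  rcases Nat.lt_or_ge t i with h1 | h1
  · rw [hl t h1, hl' t h1]
  · rcases Nat.lt_trichotomy t k with h2 | h2 | h2
    · rw [hm t h1 h2, hm' t h1 h2]
    · rw [h2, hk, hk']
    · rw [hg t h2, hg' t h2]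

lemma Mv.a_unique {n i i' k : ℕ} {a a' b : ℕ → ℤ} (h : Mv n i k a b) (h' : Mv n i' k a' b)
    (hn : 1 ≤ n) (ha : StrictAnti a) (ha' : StrictAnti a') (hb : StrictAnti b) (t : ℕ) :
    a t = a' t := by
  have key : ∀ {i i' : ℕ} {a a' : ℕ → ℤ}, Mv n i k a b → Mv n i' k a' b → StrictAnti a →
      StrictAnti a' → ¬ i < i' := by
    intro i i' a a' h h' ha ha' hlt
    have e1 := h.lt hn ha hb (le_refl i) h.1
    have e2 := ha' hlt
    have e3 := h'.2.1 i hlt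
    have e4 := h.2.2.2.2
    have e5 := h'.2.2.2.2
    omega
  obtain rfl : i = i' := by
    have := key h h' ha ha'
    have := key h' h ha' ha
    omega
  obtain ⟨h0, hl, hg, hm, hk⟩ := h
  obtain ⟨_, hl', hg', hm', hk'⟩ := h'
  rcases Nat.lt_trichotomy t i with h1 | h1 | h1
  · rw [← hl t h1, ← hl' t h1]
  · subst h1; omega
  · rcases Nat.lt_or_ge k t with h2 | h2
    · rw [← hg t h2, ← hg' t h2]
    · obtain ⟨s, rfl⟩ : ∃ s, t = s + 1 := ⟨t - 1, by omega⟩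
      rw [← hm s (by omega) (by omega), ← hm' s (by omega) (by omega)]

lemma part_one (lam : YoungDiagram) (n : ℕ) (hn : 1 ≤ n) :
    pderiv (n - 1) (schurPoly lam) =
      (∑ᶠ μ : YoungDiagram, if hookStep n μ lam then
        ((-1 : ℂ) ^ skewL (lam.cells \ μ.cells)) • schurPoly μ else 0) := by
  set N := lam.colLen 0 with hNdef
  have hN : lam.colLen 0 ≤ N := le_rfl
  have ha := beta_strictAnti lam
  rw [schurPoly_eq lam hN, pderiv_D]
  have hcast : (((n - 1 : ℕ) : ℤ) + 1) = n := by omega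
  rw [hcast]
  let G : Finset (Fin N) := Finset.univ.filter (fun i =>
    -(N : ℤ) < beta lam i - n ∧ ∀ t < N, beta lam t ≠ beta lam i - n)
  have hch : ∀ i : Fin N, ∃ mu : YoungDiagram, i ∈ G →
      ∃ k, k < N ∧ mu.colLen 0 ≤ N ∧ Mv n i k (beta lam) (beta mu) := by
    intro i
    by_cases hi : i ∈ G
    · have h1 := (Finset.mem_filter.mp hi).2
      obtain ⟨mu, k, h⟩ := exists_down lam n N hn hN i h1.1 h1.2
      exact ⟨mu, fun _ => ⟨k, h⟩⟩
    · exact ⟨⊥, fun h => absurd h hi⟩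
  choose m hm using hch
  rw [finsum_eq_sum_of_support_subset (s := G.image m)]
  · rw [Finset.sum_image]
    · rw [← Finset.sum_subset (Finset.subset_univ G)]
      · apply Finset.sum_congr rfl
        intro i hi
        obtain ⟨k, hk, hc, hmv⟩ := hm i hi
        obtain ⟨hs, hL⟩ := hookStep_of_Mv hn hmv
        rw [if_pos hs, hL, schurPoly_eq _ hc]
        exact hmv.D_down hk i.2
      · intro i _ hi
        by_cases h1 : -(N : ℤ) < beta lam i - n
        · have h2 : ¬ ∀ t < N, beta lam t ≠ beta lam i - n := fun h2 =>
            hi (Finset.mem_filter.mpr ⟨Finset.mem_univ _, h1, h2⟩)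
          push Not at h2
          obtain ⟨t, ht, he⟩ := h2
          have hne : (⟨t, ht⟩ : Fin N) ≠ i := by
            rintro rfl
            simp only at he; omega
          apply D_eq_zero_of_eq _ hne
          rw [Function.update_of_ne hne, Function.update_self, he]
        · apply D_eq_zero_of_le (i := i)
          rw [Function.update_self]; omega
    · intro i hi j hj hij
      obtain ⟨k, _, _, h1⟩ := hm i hi
      obtain ⟨k', _, _, h2⟩ := hm j hj
      rw [← hij] at h2
      exact Fin.ext (h1.i_unique h2 hn ha (beta_strictAnti _))
  · intro mu hmu
    have hs : hookStep n mu lam := by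
      by_contra hc; exact hmu (if_neg hc)
    obtain ⟨i, k, hmv⟩ := Mv_of_hookStep hs
    have hb := beta_strictAnti mu
    have hkN : k < N := by
      have h1 := hmv.lt hn ha hb hmv.1 (le_refl k)
      by_contra hc
      have h2 := beta_of_ge lam (show lam.colLen 0 ≤ k by omega)
      have h3 := beta_ge mu k
      omega
    have hiN : i < N := lt_of_le_of_lt hmv.1 hkN
    have hG : (⟨i, hiN⟩ : Fin N) ∈ G := by
      refine Finset.mem_filter.mpr ⟨Finset.mem_univ _, ?_, ?_⟩
      · have := hmv.2.2.2.2
        have h3 := beta_ge mu k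
        simp only; omega
      · intro t _
        simp only
        rw [← hmv.2.2.2.2]
        exact hmv.notMem_a hn ha hb t
    refine Finset.mem_coe.mpr (Finset.mem_image.mpr ⟨⟨i, hiN⟩, hG, ?_⟩)
    obtain ⟨k', _, _, h1⟩ := hm _ hG
    exact beta_inj (fun t => h1.b_unique hmv hn ha (beta_strictAnti _) hb t)

lemma part_two (lam : YoungDiagram) (n : ℕ) (hn : 1 ≤ n) :
    (n : ℂ) • (X (n - 1) * schurPoly lam) =
      (∑ᶠ ν : YoungDiagram, if hookStep n lam ν then
        ((-1 : ℂ) ^ skewL (ν.cells \ lam.cells)) • schurPoly ν else 0) := by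
  set N := lam.colLen 0 + n with hNdef
  have hN : lam.colLen 0 ≤ N := by omega
  have hb := beta_strictAnti lam
  have hlow : ∀ i : Fin N, -(N : ℤ) < beta lam i := by
    intro i
    have := beta_ge lam i
    have := i.2
    omega
  rw [schurPoly_eq lam hN, mul_D n hn (∑ i : Fin N, (beta lam i + N)).toNat]
  rotate_left
  · rw [Int.toNat_of_nonneg]
    apply Finset.sum_nonneg
    intro i _
    have := hlow i; omega
  · intro i j h; exact Fin.ext (hb.injective h)
  · exact hlow
  · intro t h1 h2
    refine ⟨⟨(-t).toNat, by omega⟩, ?_⟩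
    simp only
    rw [beta_of_ge lam (by omega)]; omega
  let G : Finset (Fin N) := Finset.univ.filter (fun k => ∀ t < N, beta lam t ≠ beta lam k + n)
  have hch : ∀ k : Fin N, ∃ nu : YoungDiagram, k ∈ G →
      ∃ i, i ≤ (k : ℕ) ∧ nu.colLen 0 ≤ N ∧ Mv n i k (beta nu) (beta lam) := by
    intro k
    by_cases hk : k ∈ G
    · have h1 := (Finset.mem_filter.mp hk).2
      obtain ⟨nu, i, h⟩ := exists_up lam n N hn hN k k.2 h1
      exact ⟨nu, fun _ => ⟨i, h⟩⟩
    · exact ⟨⊥, fun h => absurd h hk⟩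
  choose m hm using hch
  rw [finsum_eq_sum_of_support_subset (s := G.image m)]
  · rw [Finset.sum_image]
    · rw [← Finset.sum_subset (Finset.subset_univ G)]
      · apply Finset.sum_congr rfl
        intro k hk
        obtain ⟨i, hi, hc, hmv⟩ := hm k hk
        obtain ⟨hs, hL⟩ := hookStep_of_Mv hn hmv
        rw [if_pos hs, hL, schurPoly_eq _ hc]
        exact hmv.D_up k.2 (lt_of_le_of_lt hi k.2)
      · intro k _ hk
        have h2 : ¬ ∀ t < N, beta lam t ≠ beta lam k + n := fun h2 =>
          hk (Finset.mem_filter.mpr ⟨Finset.mem_univ _, h2⟩)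
        push Not at h2
        obtain ⟨t, ht, he⟩ := h2
        have hne : (⟨t, ht⟩ : Fin N) ≠ k := by
          rintro rfl
          simp only at he; omega
        apply D_eq_zero_of_eq _ hne
        rw [Function.update_of_ne hne, Function.update_self, he]
    · intro k hk j hj hkj
      obtain ⟨i, _, _, h1⟩ := hm k hk
      obtain ⟨i', _, _, h2⟩ := hm j hj
      rw [← hkj] at h2
      exact Fin.ext (h1.k_unique h2 hn (beta_strictAnti _) hb)
  · intro nu hnu
    have hs : hookStep n lam nu := by
      by_contra hc; exact hnu (if_neg hc)
    obtain ⟨i, k, hmv⟩ := Mv_of_hookStep hs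
    have ha := beta_strictAnti nu
    have hkN : k < N := by
      by_contra hc
      have h2 := beta_of_ge lam (show lam.colLen 0 ≤ k by omega)
      have h3 := beta_of_ge lam (show lam.colLen 0 ≤ k - n by omega)
      have h4 := hmv.2.2.2.2
      apply hmv.notMem_b hn ha hb (k - n)
      omega
    have hG : (⟨k, hkN⟩ : Fin N) ∈ G := by
      refine Finset.mem_filter.mpr ⟨Finset.mem_univ _, ?_⟩
      intro t _
      have h4 := hmv.2.2.2.2
      have h5 := hmv.notMem_b hn ha hb t
      simp only
      omega
    refine Finset.mem_coe.mpr (Finset.mem_image.mpr ⟨⟨k, hkN⟩, hG, ?_⟩)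
    obtain ⟨i', _, _, h1⟩ := hm _ hG
    exact beta_inj (fun t => h1.a_unique hmv hn (beta_strictAnti _) ha hb t)

end BF

/-- **Boson–Fermion correspondence, explicit form.**  For every partition `λ` and every
`n ≥ 1`:  `∂S_λ/∂xₙ = Σ_μ (−1)^{L(λ/μ)} S_μ`, summed over `μ ⊆ λ` with `λ/μ` a skew
hook with `n` boxes; and `n xₙ S_λ = Σ_ν (−1)^{L(ν/λ)} S_ν`, summed over `ν ⊇ λ` with
`ν/λ` a skew hook with `n` boxes.  (The variable `xₙ` is `MvPolynomial.X (n-1)`.)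
Equivalently, the linear isomorphism `ℱ → ℂ[x₁, x₂, …]`, `v_λ ↦ S_λ`, intertwines `Λ_n`
with `∂/∂xₙ` and `Λ_{−n}` with multiplication by `n xₙ`. -/
theorem boson_fermion_explicit (lam : YoungDiagram) (n : ℕ) (hn : 1 ≤ n) :
    MvPolynomial.pderiv (n - 1) (schurPoly lam) =
      (∑ᶠ μ : YoungDiagram, if hookStep n μ lam then
        ((-1 : ℂ) ^ skewL (lam.cells \ μ.cells)) • schurPoly μ else 0) ∧
    (n : ℂ) • (MvPolynomial.X (n - 1) * schurPoly lam) =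
      (∑ᶠ ν : YoungDiagram, if hookStep n lam ν then
        ((-1 : ℂ) ^ skewL (ν.cells \ lam.cells)) • schurPoly ν else 0) := by
  exact ⟨BF.part_one lam n hn, BF.part_two lam n hn⟩
end
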